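/- arXiv:2404.02165 — 2 statements merged into one kernel-verified Lean document; each statement's English description precedes it below -/
import Mathlib

section
/- Let n ≥ 1 and let f ∈ 𝒮(ℝⁿ, ℂ) be a Schwartz function, with Fourier transform normalized as f̂(ξ) = (2π)^{-n/2} ∫_{ℝⁿ} e^{-i⟨x,ξ⟩} f(x) dx. Then for every λ with 0 ≤ λ < n, Pitt's inequality holds: ∫_{ℝⁿ} |ξ|^{-λ} |f̂(ξ)|² dξ ≤ 2^{-λ} (Γ((n-λ)/4) / Γ((n+λ)/4))² ∫_{ℝⁿ} |x|^{λ} |f(x)|² dx, where Γ is the real Gamma function. -/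
open MeasureTheory Real
open scoped RealInnerProductSpace

/-- The Fourier transform on `ℝⁿ` with the normalization
`f̂(ξ) = (2π)^{-n/2} ∫ e^{-i⟨x,ξ⟩} f(x) dx`. -/
noncomputable def fourierTr {n : ℕ} (f : EuclideanSpace ℝ (Fin n) → ℂ)
    (ξ : EuclideanSpace ℝ (Fin n)) : ℂ :=
  (((2 * π) ^ (-(n : ℝ) / 2) : ℝ) : ℂ) *
    ∫ x, Complex.exp (-Complex.I * (⟪x, ξ⟫ : ℝ)) * f x



lemma pitt_gamma {p c : ℝ} (hp : 0 < p) (hc : 0 < c) :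
    ∫⁻ t in Set.Ioi (0:ℝ), ENNReal.ofReal (t ^ (p - 1) * exp (-(c * t))) =
      ENNReal.ofReal (Gamma p * c ^ (-p)) := by
  have h := integral_rpow_mul_exp_neg_mul_Ioi hp hc
  have h0 : (1 / c) ^ p * Gamma p = Gamma p * c ^ (-p) := by
    rw [one_div, inv_rpow hc.le, rpow_neg hc.le, mul_comm]
  rw [h0] at h
  rw [← h, ofReal_integral_eq_lintegral_ofReal]
  · apply Integrable.of_integral_ne_zero
    rw [h]
    have := Gamma_pos_of_pos hp
    positivity
  · filter_upwards [ae_restrict_mem measurableSet_Ioi] with t ht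
    have : 0 < t := ht
    simp only [Pi.zero_apply]; positivity

lemma pitt_gamma_inv {p c : ℝ} (hp : 0 < p) (hc : 0 < c) :
    ∫⁻ t in Set.Ioi (0:ℝ), ENNReal.ofReal (t ^ (-p - 1) * exp (-(c / t))) =
      ENNReal.ofReal (Gamma p * c ^ (-p)) := by
  have h := integral_rpow_mul_exp_neg_mul_Ioi hp hc
  rw [← integral_comp_rpow_Ioi _ (show (-1:ℝ) ≠ 0 by norm_num)] at h
  have h0 : (1 / c) ^ p * Gamma p = Gamma p * c ^ (-p) := by
    rw [one_div, inv_rpow hc.le, rpow_neg hc.le, mul_comm]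
  rw [h0] at h
  have h1 : ∫ t in Set.Ioi (0:ℝ), t ^ (-p - 1) * exp (-(c / t)) = Gamma p * c ^ (-p) := by
    rw [← h]
    refine setIntegral_congr_fun measurableSet_Ioi fun t (ht : 0 < t) => ?_
    simp only [smul_eq_mul, abs_neg, abs_one, one_mul]
    rw [← rpow_mul ht.le, ← mul_assoc, ← rpow_add ht, rpow_neg_one]
    ring_nf
  rw [← h1, ofReal_integral_eq_lintegral_ofReal]
  · apply Integrable.of_integral_ne_zero
    rw [h1]
    have := Gamma_pos_of_pos hp
    positivity
  · filter_upwards [ae_restrict_mem measurableSet_Ioi] with t ht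
    have : 0 < t := ht
    simp only [Pi.zero_apply]; positivity

lemma pitt_beta_aux {a b w : ℝ} (ha : 0 < a) (hb : 0 < b) (hw : 0 < w) :
    ∫⁻ t, (Set.Ioi (0:ℝ)).indicator (fun t => ENNReal.ofReal (t ^ (a-1))) t *
      (Set.Ioi (0:ℝ)).indicator (fun t => ENNReal.ofReal (t ^ (b-1))) (w - t) =
    ENNReal.ofReal (ProbabilityTheory.beta a b * w ^ (a + b - 1)) := by
  have hB := ProbabilityTheory.beta_pos ha hb
  have h1 : ∀ t, (Set.Ioi (0:ℝ)).indicator (fun t => ENNReal.ofReal (t ^ (a-1))) t *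
      (Set.Ioi (0:ℝ)).indicator (fun t => ENNReal.ofReal (t ^ (b-1))) (w - t) =
      ENNReal.ofReal (ProbabilityTheory.beta a b * w ^ (a + b - 2)) *
        ProbabilityTheory.betaPDF a b (w⁻¹ * t) := by
    intro t
    rw [ProbabilityTheory.betaPDF_eq]
    by_cases h : 0 < t ∧ t < w
    · have e1 : 0 < w⁻¹ * t := by have := h.1; positivity
      have e2 : w⁻¹ * t < 1 := by rw [inv_mul_lt_iff₀ hw]; simpa using h.2
      have h3 : 0 < w - t := by linarith [h.2]
      rw [if_pos ⟨e1, e2⟩, Set.indicator_of_mem (by exact h.1),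
        Set.indicator_of_mem (by exact h3), ← ENNReal.ofReal_mul (by have := h.1; positivity),
        ← ENNReal.ofReal_mul (by positivity)]
      congr 1
      have e3 : 1 - w⁻¹ * t = w⁻¹ * (w - t) := by field_simp
      rw [e3, mul_rpow (by positivity) h.1.le, mul_rpow (by positivity) h3.le,
        inv_rpow hw.le, inv_rpow hw.le, show a + b - 2 = (a-1) + (b-1) by ring, rpow_add hw]
      have := rpow_pos_of_pos hw (a-1)
      have := rpow_pos_of_pos hw (b-1)
      field_simp
    · rw [if_neg]
      · simp only [ENNReal.ofReal_zero, mul_zero, mul_eq_zero, Set.indicator_apply_eq_zero]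
        by_cases h0 : 0 < t
        · right
          intro h2
          have h2 : 0 < w - t := h2
          exact absurd ⟨h0, by linarith⟩ h
        · left; intro h2; exact absurd h2 h0
      · rintro ⟨e1, e2⟩
        apply h
        rw [inv_mul_lt_iff₀ hw] at e2
        exact ⟨by simpa [hw] using e1, by simpa using e2⟩
  simp_rw [h1]
  have hm : Measurable (ProbabilityTheory.betaPDF a b) :=
    (ProbabilityTheory.measurable_betaPDFReal a b).ennreal_ofReal
  rw [lintegral_const_mul _ (by fun_prop),
    ← lintegral_map (g := fun t => w⁻¹ * t) hm (measurable_const_mul _),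
    Real.map_volume_mul_left (by positivity), lintegral_smul_measure,
    ProbabilityTheory.lintegral_betaPDF_eq_one ha hb, inv_inv, abs_of_pos hw, smul_eq_mul, mul_one,
    ← ENNReal.ofReal_mul (by positivity), mul_assoc, show a + b - 1 = (a + b - 2) + 1 by ring,
    rpow_add_one hw.ne']

lemma pitt_beta {a b : ℝ} (ha : 0 < a) (hb : 0 < b) (φ : ℝ → ENNReal) (hφ : Measurable φ) :
    ∫⁻ t in Set.Ioi (0:ℝ), ∫⁻ r in Set.Ioi (0:ℝ),
      ENNReal.ofReal (t ^ (a-1)) * ENNReal.ofReal (r ^ (b-1)) * φ (r + t) =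
    ENNReal.ofReal (ProbabilityTheory.beta a b) *
      ∫⁻ w in Set.Ioi (0:ℝ), ENNReal.ofReal (w ^ (a + b - 1)) * φ w := by
  set P := (Set.Ioi (0:ℝ)).indicator (fun t => ENNReal.ofReal (t ^ (a-1))) with hP
  set Q := (Set.Ioi (0:ℝ)).indicator (fun t => ENNReal.ofReal (t ^ (b-1))) with hQ
  have mP : Measurable P := Measurable.indicator (by fun_prop) measurableSet_Ioi
  have mQ : Measurable Q := Measurable.indicator (by fun_prop) measurableSet_Ioi
  have hB := ProbabilityTheory.beta_pos ha hb
  calc _ = ∫⁻ t, ∫⁻ r, P t * Q r * φ (r + t) := by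
        rw [← lintegral_indicator measurableSet_Ioi]
        congr 1; ext t
        by_cases ht : t ∈ Set.Ioi (0:ℝ)
        · rw [Set.indicator_of_mem ht, ← lintegral_indicator measurableSet_Ioi]
          congr 1; ext r
          by_cases hr : r ∈ Set.Ioi (0:ℝ)
          · simp [hP, hQ, Set.indicator_of_mem ht, Set.indicator_of_mem hr]
          · simp [hQ, Set.indicator_of_notMem hr]
        · simp [hP, Set.indicator_of_notMem ht]
    _ = ∫⁻ t, ∫⁻ w, P t * Q (w - t) * φ w := by
        congr 1; ext t
        rw [← lintegral_add_right_eq_self (fun w => P t * Q (w - t) * φ w) t]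
        simp
    _ = ∫⁻ w, ∫⁻ t, P t * Q (w - t) * φ w := by
        apply lintegral_lintegral_swap
        apply Measurable.aemeasurable
        simp only [Function.uncurry_def]
        fun_prop
    _ = ∫⁻ w, φ w * ∫⁻ t, P t * Q (w - t) := by
        congr 1; ext w
        rw [lintegral_mul_const _ (by fun_prop), mul_comm]
    _ = ∫⁻ w in Set.Ioi (0:ℝ), φ w * ∫⁻ t, P t * Q (w - t) := by
        rw [← lintegral_indicator measurableSet_Ioi]
        congr 1; ext w
        by_cases hw : w ∈ Set.Ioi (0:ℝ)
        · rw [Set.indicator_of_mem hw]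
        · rw [Set.indicator_of_notMem hw]
          have : ∀ t, P t * Q (w - t) = 0 := by
            intro t
            simp only [hP, hQ, mul_eq_zero, Set.indicator_apply_eq_zero]
            by_cases h0 : 0 < t
            · right
              intro h2
              have h2 : 0 < w - t := h2
              exact absurd (show 0 < w by linarith) hw
            · left; intro h2; exact absurd h2 h0
          simp [this]
    _ = ∫⁻ w in Set.Ioi (0:ℝ), ENNReal.ofReal (ProbabilityTheory.beta a b) * (ENNReal.ofReal (w ^ (a + b - 1)) * φ w) := by
        refine setLIntegral_congr_fun measurableSet_Ioi fun w (hw : 0 < w) => ?_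
        rw [hP, hQ, pitt_beta_aux ha hb hw, ENNReal.ofReal_mul hB.le]
        ring
    _ = _ := by
        rw [lintegral_const_mul _ (by fun_prop)]

lemma pitt_conv {n : ℕ} {r t : ℝ} (hr : 0 < r) (ht : 0 < t) (x : EuclideanSpace ℝ (Fin n)) :
    ∫⁻ y, ENNReal.ofReal (exp (-(‖x - y‖^2/t)) * exp (-(‖y‖^2/r))) =
     ENNReal.ofReal ((π * (r * t / (r + t))) ^ ((n:ℝ)/2) * exp (-(‖x‖^2/(r+t)))) := by
  have hb : 0 < 1/t + 1/r := by positivity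
  have h := GaussianFourier.integral_cexp_neg_mul_sq_norm_add (V := EuclideanSpace ℝ (Fin n))
    (b := ((1/t+1/r : ℝ):ℂ)) (by simpa using hb) ((2/t : ℝ):ℂ) x
  have e : ∀ y : EuclideanSpace ℝ (Fin n),
     (Complex.exp (-((1/t+1/r : ℝ):ℂ) * ‖y‖^2 + ((2/t : ℝ):ℂ) * (⟪x, y⟫ : ℝ))) =
     ((exp (-(1/t+1/r) * ‖y‖^2 + 2/t * ⟪x, y⟫) : ℝ) : ℂ) := by
    intro y; push_cast; rfl
  simp_rw [e] at h
  rw [integral_complex_ofReal] at h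
  have h2 : ∫ y : EuclideanSpace ℝ (Fin n), exp (-(1/t+1/r) * ‖y‖^2 + 2/t * ⟪x, y⟫) =
     (π * (r * t / (r + t))) ^ ((n:ℝ)/2) * exp ((2/t)^2 * ‖x‖^2 / (4 * (1/t+1/r))) := by
    apply Complex.ofReal_injective
    rw [h]
    push_cast
    rw [Complex.ofReal_cpow (by positivity)]
    have : (π / (1/t+1/r) : ℂ) = ((π * (r * t / (r + t)) : ℝ) : ℂ) := by
      have : π / (1/t+1/r) = π * (r * t / (r + t)) := by field_simp
      rw [← this]; push_cast; rfl
    rw [this]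
    simp
  have h3 : ∀ y : EuclideanSpace ℝ (Fin n), exp (-(‖x - y‖^2/t)) * exp (-(‖y‖^2/r)) =
     exp (-(‖x‖^2/t)) * exp (-(1/t+1/r) * ‖y‖^2 + 2/t * ⟪x, y⟫) := by
    intro y
    rw [← exp_add, ← exp_add, norm_sub_sq_real]
    congr 1; field_simp; ring
  have h4 : ∫ y : EuclideanSpace ℝ (Fin n), exp (-(‖x - y‖^2/t)) * exp (-(‖y‖^2/r)) =
     (π * (r * t / (r + t))) ^ ((n:ℝ)/2) * exp (-(‖x‖^2/(r+t))) := by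
    simp_rw [h3]
    rw [integral_const_mul, h2, mul_left_comm, ← exp_add]
    congr 2
    field_simp; ring
  rw [← h4, ofReal_integral_eq_lintegral_ofReal]
  · apply Integrable.of_integral_ne_zero
    rw [h4]
    positivity
  · filter_upwards with t
    simp only [Pi.zero_apply]; positivity

lemma pitt_D {n : ℕ} (hn : 1 ≤ n) {a b m : ℝ} (hb : 0 < b) (hm : 0 < m) (ha : a = b + m)
    (hnn : (n:ℝ)/2 = a + b) (x : EuclideanSpace ℝ (Fin n)) (hx : x ≠ 0) :
    ∫⁻ t in Set.Ioi (0:ℝ), ENNReal.ofReal (t ^ (m-1)) * (ENNReal.ofReal ((π * t) ^ (-((n:ℝ)/2))) *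
      ∫⁻ y : EuclideanSpace ℝ (Fin n), ENNReal.ofReal (exp (-(‖x-y‖^2/t))) *
        ENNReal.ofReal (‖y‖ ^ (-(2*a)))) =
    ENNReal.ofReal (Gamma m * (Gamma b / Gamma a) ^ 2 * ‖x‖ ^ (-(2*b))) := by
  have ha0 : 0 < a := by linarith
  have hGa := Gamma_pos_of_pos ha0
  have hGb := Gamma_pos_of_pos hb
  have hGm := Gamma_pos_of_pos hm
  have : Nonempty (Fin n) := ⟨⟨0, hn⟩⟩
  have hW : ∀ᵐ y : EuclideanSpace ℝ (Fin n), ENNReal.ofReal (‖y‖ ^ (-(2*a))) =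
      ENNReal.ofReal (1 / Gamma a) *
        ∫⁻ r in Set.Ioi (0:ℝ), ENNReal.ofReal (r ^ (-a-1) * exp (-(‖y‖^2/r))) := by
    filter_upwards [Measure.ae_ne volume (0 : EuclideanSpace ℝ (Fin n))] with y hy
    have hy : 0 < ‖y‖ := norm_pos_iff.2 hy
    rw [pitt_gamma_inv ha0 (by positivity), ← ENNReal.ofReal_mul (by positivity),
      ← rpow_natCast_mul hy.le]
    congr 1
    push_cast
    field_simp
  have hin : ∀ t : ℝ, 0 < t → ∫⁻ y : EuclideanSpace ℝ (Fin n),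
      ENNReal.ofReal (exp (-(‖x-y‖^2/t))) * ENNReal.ofReal (‖y‖ ^ (-(2*a))) =
      ENNReal.ofReal (1 / Gamma a) * ∫⁻ r in Set.Ioi (0:ℝ), ENNReal.ofReal (r ^ (-a-1)) *
        ENNReal.ofReal ((π * (r * t / (r + t))) ^ ((n:ℝ)/2) * exp (-(‖x‖^2/(r+t)))) := by
    intro t ht
    calc _ = ∫⁻ y : EuclideanSpace ℝ (Fin n), ENNReal.ofReal (1 / Gamma a) *
              ∫⁻ r in Set.Ioi (0:ℝ), ENNReal.ofReal (exp (-(‖x-y‖^2/t))) *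
               ENNReal.ofReal (r ^ (-a-1) * exp (-(‖y‖^2/r))) := by
          apply lintegral_congr_ae
          filter_upwards [hW] with y hy
          rw [hy, mul_left_comm, lintegral_const_mul _ (by fun_prop)]
      _ = ENNReal.ofReal (1 / Gamma a) * ∫⁻ y : EuclideanSpace ℝ (Fin n),
              ∫⁻ r in Set.Ioi (0:ℝ), ENNReal.ofReal (exp (-(‖x-y‖^2/t))) *
               ENNReal.ofReal (r ^ (-a-1) * exp (-(‖y‖^2/r))) := by
          rw [lintegral_const_mul]
          apply Measurable.lintegral_prod_right
          fun_prop
      _ = ENNReal.ofReal (1 / Gamma a) * ∫⁻ r in Set.Ioi (0:ℝ), ∫⁻ y : EuclideanSpace ℝ (Fin n),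
              ENNReal.ofReal (exp (-(‖x-y‖^2/t))) *
               ENNReal.ofReal (r ^ (-a-1) * exp (-(‖y‖^2/r))) := by
          rw [lintegral_lintegral_swap]
          apply Measurable.aemeasurable
          simp only [Function.uncurry_def]
          fun_prop
      _ = _ := by
          congr 1
          refine setLIntegral_congr_fun measurableSet_Ioi fun r (hr : 0 < r) => ?_
          rw [← pitt_conv hr ht, ← lintegral_const_mul _ (by fun_prop)]
          congr 1; ext y
          rw [ENNReal.ofReal_mul (by positivity), ENNReal.ofReal_mul (by positivity)]
          ring
  set φ : ℝ → ENNReal := fun w => ENNReal.ofReal (w ^ (-((n:ℝ)/2)) * exp (-(‖x‖^2/w))) with hφ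
  have hφm : Measurable φ := by fun_prop
  calc _ = ∫⁻ t in Set.Ioi (0:ℝ), ENNReal.ofReal (1 / Gamma a) * ∫⁻ r in Set.Ioi (0:ℝ),
      ENNReal.ofReal (t ^ (m-1)) * ENNReal.ofReal (r ^ (b-1)) * φ (r + t) := by
        refine setLIntegral_congr_fun measurableSet_Ioi fun t (ht : 0 < t) => ?_
        rw [hin t ht, mul_left_comm (ENNReal.ofReal ((π * t) ^ _)), mul_left_comm,
          ← lintegral_const_mul _ (by fun_prop), ← lintegral_const_mul _ (by fun_prop)]
        congr 1
        refine setLIntegral_congr_fun measurableSet_Ioi fun r (hr : 0 < r) => ?_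
        simp only [hφ]
        repeat rw [← ENNReal.ofReal_mul (by positivity)]
        congr 1
        have e1 : (π * (r * t / (r + t))) ^ ((n:ℝ)/2) =
            (π * t) ^ ((n:ℝ)/2) * r ^ ((n:ℝ)/2) * (r+t) ^ (-((n:ℝ)/2)) := by
          rw [← mul_rpow (by positivity) hr.le, rpow_neg (by positivity),
            ← inv_rpow (by positivity), ← mul_rpow (by positivity) (by positivity)]
          congr 1; field_simp
        have e2 : r ^ (b - 1) = r ^ (-a-1) * r ^ ((n:ℝ)/2) := by
          rw [← rpow_add hr, hnn]; congr 1; ring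
        rw [e1, e2, rpow_neg (by positivity : 0 ≤ π * t)]
        have : 0 < (π * t) ^ ((n:ℝ)/2) := by positivity
        field_simp
    _ = ENNReal.ofReal (1 / Gamma a) * (ENNReal.ofReal (ProbabilityTheory.beta m b) *
          ∫⁻ w in Set.Ioi (0:ℝ), ENNReal.ofReal (w ^ (m + b - 1)) * φ w) := by
        rw [← pitt_beta hm hb φ hφm, lintegral_const_mul]
        apply Measurable.lintegral_prod_right
        fun_prop
    _ = ENNReal.ofReal (1 / Gamma a) * (ENNReal.ofReal (ProbabilityTheory.beta m b) *
          ENNReal.ofReal (Gamma b * (‖x‖^2) ^ (-b))) := by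
        have : 0 < ‖x‖ := norm_pos_iff.2 hx
        rw [← pitt_gamma_inv hb (by positivity)]
        congr 2
        refine setLIntegral_congr_fun measurableSet_Ioi fun r (hr : 0 < r) => ?_
        simp only [hφ]
        rw [← ENNReal.ofReal_mul (by positivity), ← mul_assoc, ← rpow_add hr]
        congr 3
        rw [hnn]; linarith
    _ = _ := by
        rw [← ENNReal.ofReal_mul (ProbabilityTheory.beta_pos hm hb).le,
          ← ENNReal.ofReal_mul (by positivity)]
        congr 1
        rw [← rpow_natCast_mul (norm_nonneg x), ProbabilityTheory.beta, ha, add_comm m b]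
        push_cast
        rw [ha] at hGa
        field_simp


lemma pitt_amgm (u v : ENNReal) : 2 * u * v ≤ u ^ 2 + v ^ 2 := by
  rcases le_total u v with h | h
  · obtain ⟨d, rfl⟩ := exists_add_of_le h
    have : u ^ 2 + (u + d) ^ 2 = 2 * u * (u + d) + d ^ 2 := by ring
    rw [this]; exact le_self_add
  · obtain ⟨d, rfl⟩ := exists_add_of_le h
    have : (v + d) ^ 2 + v ^ 2 = 2 * (v + d) * v + d ^ 2 := by ring
    rw [this]; exact le_self_add

lemma pitt_schur_gen {α : Type*} [MeasurableSpace α] (μ : Measure α) [SFinite μ]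
    (g V W : α → ENNReal) (E : α → α → ENNReal)
    (hg : Measurable g) (mV : Measurable V) (mW : Measurable W)
    (mE : Measurable (Function.uncurry E)) (sE : ∀ x y, E x y = E y x)
    (hVW : ∀ᵐ x ∂μ, ∀ᵐ y ∂μ, 2 * (g x * g y) ≤ g x ^ 2 * (V x * W y) + g y ^ 2 * (V y * W x)) :
    ∫⁻ x, ∫⁻ y, g x * g y * E x y ∂μ ∂μ ≤ ∫⁻ x, g x ^ 2 * V x * ∫⁻ y, E x y * W y ∂μ ∂μ := by
  have mE1 : ∀ x, Measurable (E x) := fun x => mE.comp measurable_prodMk_left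
  have mE2 : Measurable (fun p : α × α => E p.1 p.2) := mE
  have mE3 : Measurable (fun p : α × α => E p.2 p.1) := mE.comp measurable_swap
  have key : 2 * ∫⁻ x, ∫⁻ y, g x * g y * E x y ∂μ ∂μ ≤
      2 * ∫⁻ x, g x ^ 2 * V x * ∫⁻ y, E x y * W y ∂μ ∂μ := by
    calc _ = ∫⁻ x, ∫⁻ y, 2 * (g x * g y * E x y) ∂μ ∂μ := by
          rw [← lintegral_const_mul' _ _ (by norm_num)]
          congr 1; ext x
          rw [lintegral_const_mul' _ _ (by norm_num)]
      _ ≤ ∫⁻ x, ∫⁻ y, (g x ^ 2 * V x * (E x y * W y) + g y ^ 2 * V y * (E y x * W x)) ∂μ ∂μ := by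
          apply lintegral_mono_ae
          filter_upwards [hVW] with x hx
          apply lintegral_mono_ae
          filter_upwards [hx] with y e1
          rw [sE y x]
          calc 2 * (g x * g y * E x y) = 2 * (g x * g y) * E x y := by ring
            _ ≤ (g x ^ 2 * (V x * W y) + g y ^ 2 * (V y * W x)) * E x y := by gcongr
            _ = _ := by ring
      _ = ∫⁻ x, ((∫⁻ y, g x ^ 2 * V x * (E x y * W y) ∂μ) +
            ∫⁻ y, g y ^ 2 * V y * (E y x * W x) ∂μ) ∂μ := by
          congr 1; ext x
          have := mE1 x
          rw [lintegral_add_left (by fun_prop)]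
      _ = (∫⁻ x, ∫⁻ y, g x ^ 2 * V x * (E x y * W y) ∂μ ∂μ) +
            ∫⁻ x, ∫⁻ y, g y ^ 2 * V y * (E y x * W x) ∂μ ∂μ := by
          rw [lintegral_add_left]
          apply Measurable.lintegral_prod_right
          fun_prop
      _ = (∫⁻ x, ∫⁻ y, g x ^ 2 * V x * (E x y * W y) ∂μ ∂μ) +
            ∫⁻ y, ∫⁻ x, g y ^ 2 * V y * (E y x * W x) ∂μ ∂μ := by
          congr 1
          apply lintegral_lintegral_swap
          apply Measurable.aemeasurable
          simp only [Function.uncurry_def]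
          fun_prop
      _ = _ := by
          rw [← two_mul]
          congr 2; ext x
          have := mE1 x
          rw [lintegral_const_mul _ (by fun_prop)]
  exact (ENNReal.mul_le_mul_iff_right (by norm_num) (by norm_num)).1 key

lemma pitt_schur_pt (u v : ENNReal) {p q : ℝ} (hx : 0 < p) (hy : 0 < q) (a : ℝ) :
    2 * (u * v) ≤ u ^ 2 * (ENNReal.ofReal (p ^ (2*a)) * ENNReal.ofReal (q ^ (-(2*a)))) +
      v ^ 2 * (ENNReal.ofReal (q ^ (2*a)) * ENNReal.ofReal (p ^ (-(2*a)))) := by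
  have e2 : ∀ p q : ℝ, 0 < p → 0 < q → ENNReal.ofReal (p ^ (2*a)) * ENNReal.ofReal (q ^ (-(2*a)))
      = ENNReal.ofReal (p^a * q^(-a)) ^ 2 := by
    intro p q hp hq
    rw [← ENNReal.ofReal_mul (by positivity), ← ENNReal.ofReal_pow (by positivity), mul_pow,
      ← rpow_mul_natCast hp.le, ← rpow_mul_natCast hq.le]
    push_cast; ring_nf
  have e4 : ENNReal.ofReal (p^a * q^(-a)) * ENNReal.ofReal (q^a * p^(-a)) = 1 := by
    rw [← ENNReal.ofReal_mul (by positivity), rpow_neg hx.le, rpow_neg hy.le,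
      ← ENNReal.ofReal_one]
    congr 1
    have := rpow_pos_of_pos hx a
    have := rpow_pos_of_pos hy a
    field_simp
  rw [e2 p q hx hy, e2 q p hy hx, ← mul_pow, ← mul_pow]
  calc 2 * (u * v) = 2 * (u * ENNReal.ofReal (p^a * q^(-a))) *
          (v * ENNReal.ofReal (q^a * p^(-a))) := by
        rw [mul_assoc, mul_mul_mul_comm, e4, mul_one]
    _ ≤ _ := pitt_amgm _ _

lemma pitt_schur {n : ℕ} (hn : 1 ≤ n) (g : EuclideanSpace ℝ (Fin n) → ENNReal) (hg : Measurable g)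
    (a t : ℝ) :
    ∫⁻ x : EuclideanSpace ℝ (Fin n), ∫⁻ y : EuclideanSpace ℝ (Fin n),
      g x * g y * ENNReal.ofReal (exp (-(‖x-y‖^2/t))) ≤
    ∫⁻ x : EuclideanSpace ℝ (Fin n), g x ^ 2 * ENNReal.ofReal (‖x‖ ^ (2*a)) *
      ∫⁻ y : EuclideanSpace ℝ (Fin n), ENNReal.ofReal (exp (-(‖x-y‖^2/t))) *
        ENNReal.ofReal (‖y‖ ^ (-(2*a))) := by
  have : Nonempty (Fin n) := ⟨⟨0, hn⟩⟩
  have h0 := Measure.ae_ne volume (0 : EuclideanSpace ℝ (Fin n))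
  apply pitt_schur_gen volume g (fun x => ENNReal.ofReal (‖x‖ ^ (2*a)))
    (fun x => ENNReal.ofReal (‖x‖ ^ (-(2*a)))) (fun x y => ENNReal.ofReal (exp (-(‖x-y‖^2/t)))) hg
  · fun_prop
  · fun_prop
  · simp only [Function.uncurry_def]; fun_prop
  · intro x y; rw [norm_sub_rev]
  · filter_upwards [h0] with x hx
    filter_upwards [h0] with y hy
    exact pitt_schur_pt _ _ (norm_pos_iff.2 hx) (norm_pos_iff.2 hy) a

lemma pitt_heat {n : ℕ} (f : SchwartzMap (EuclideanSpace ℝ (Fin n)) ℂ) {t : ℝ} (ht : 0 < t) :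
    ∫⁻ ξ : EuclideanSpace ℝ (Fin n), ENNReal.ofReal (exp (-(‖ξ‖^2/4 * t))) *
        ENNReal.ofReal (‖fourierTr (⇑f) ξ‖ ^ 2) ≤
    ENNReal.ofReal ((π * t) ^ (-((n:ℝ)/2))) *
      ∫⁻ x : EuclideanSpace ℝ (Fin n), ∫⁻ y : EuclideanSpace ℝ (Fin n),
      ‖f x‖ₑ * ‖f y‖ₑ * ENNReal.ofReal (exp (-(‖x-y‖^2/t))) := by
  let V := EuclideanSpace ℝ (Fin n)
  set S : V → ℂ := fun ξ => ∫ x, Complex.exp (-Complex.I * (⟪x, ξ⟫ : ℝ)) * f x with hS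
  set F : V → V × V → ℂ := fun ξ p => ((exp (-(‖ξ‖^2/4 * t)) : ℝ) : ℂ) *
    ((Complex.exp (-Complex.I * (⟪p.1, ξ⟫ : ℝ)) * f p.1) *
      (starRingEnd ℂ) (Complex.exp (-Complex.I * (⟪p.2, ξ⟫ : ℝ)) * f p.2)) with hF
  have hI : ∀ ξ, ∫ p, F ξ p = ((exp (-(‖ξ‖^2/4 * t)) * ‖S ξ‖^2 : ℝ) : ℂ) := by
    intro ξ
    simp only [hF]
    rw [integral_const_mul, Measure.volume_eq_prod,
      integral_prod_mul (fun x : V => Complex.exp (-Complex.I * (⟪x, ξ⟫ : ℝ)) * f x)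
       (fun x : V => (starRingEnd ℂ) (Complex.exp (-Complex.I * (⟪x, ξ⟫ : ℝ)) * f x)),
       integral_conj, Complex.mul_conj, Complex.normSq_eq_norm_sq]
    push_cast
    rfl
  have hJ : ∀ p : V × V, ∫ ξ, F ξ p = f p.1 * (starRingEnd ℂ) (f p.2) *
      (((4 * π / t) ^ ((n:ℝ)/2) * exp (-(‖p.1 - p.2‖^2/t)) : ℝ) : ℂ) := by
    intro p
    have h := GaussianFourier.integral_cexp_neg_mul_sq_norm_add (V := V)
      (b := ((t/4 : ℝ):ℂ)) (by simp; positivity) (-Complex.I) (p.1 - p.2)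
    have e : ∀ ξ, F ξ p = (f p.1 * (starRingEnd ℂ) (f p.2)) *
        Complex.exp (-((t/4 : ℝ):ℂ) * ‖ξ‖^2 + (-Complex.I) * (⟪p.1 - p.2, ξ⟫ : ℝ)) := by
      intro ξ
      simp only [hF, map_mul, ← Complex.exp_conj, Complex.conj_ofReal, map_neg, Complex.conj_I]
      rw [inner_sub_left, show -((t/4 : ℝ):ℂ) * ‖ξ‖^2 + (-Complex.I) * ((⟪p.1, ξ⟫ - ⟪p.2, ξ⟫ : ℝ) : ℂ)
        = ((-(‖ξ‖^2/4 * t) : ℝ) : ℂ) + (-Complex.I) * (⟪p.1, ξ⟫ : ℝ) + - -Complex.I * (⟪p.2, ξ⟫ : ℝ) by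
          push_cast; ring, Complex.exp_add, Complex.exp_add, Complex.ofReal_exp]
      ring
    simp_rw [e]
    rw [integral_const_mul, h]
    congr 1
    rw [Complex.ofReal_mul, Complex.ofReal_cpow (by positivity)]
    congr 1
    · have e1 : (π / ((t/4 : ℝ):ℂ) : ℂ) = ((4 * π / t : ℝ) : ℂ) := by
        push_cast; field_simp
      rw [e1]
      simp [V]
    · rw [Complex.ofReal_exp]
      congr 1
      have ht' : (t:ℂ) ≠ 0 := by exact_mod_cast ht.ne'
      push_cast
      rw [neg_sq, Complex.I_sq]
      field_simp
  have hfi : Integrable (fun x => f x) (volume : Measure V) := f.integrable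
  have hfi2 : Integrable (fun x => (starRingEnd ℂ) (f x)) (volume : Measure V) := by
    exact (Complex.conjCLE.toContinuousLinearMap.integrable_comp hfi :)
  have hgi : Integrable (fun ξ : V => ((exp (-(‖ξ‖^2/4 * t)) : ℝ) : ℂ)) volume := by
    have := GaussianFourier.integrable_cexp_neg_mul_sq_norm_add (V := V)
      (b := ((t/4 : ℝ):ℂ)) (by simp; positivity) 0 0
    refine this.congr (ae_of_all _ fun ξ => ?_)
    simp only
    rw [Complex.ofReal_exp]
    congr 1
    push_cast; simp; ring
  have hint : Integrable (Function.uncurry F) (volume.prod volume) := by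
    have h1 := hgi.mul_prod (hfi.mul_prod hfi2)
    refine h1.mono ?_ (ae_of_all _ fun q => ?_)
    · apply Continuous.aestronglyMeasurable
      simp only [hF, Function.uncurry_def]
      have := f.continuous
      fun_prop
    · simp only [hF, Function.uncurry_def, norm_mul, RCLike.norm_conj]
      have e : ∀ s : ℝ, ‖Complex.exp (-Complex.I * s)‖ = 1 := by
        intro s; rw [Complex.norm_exp]; simp
      simp only [e, one_mul]
      exact le_rfl
  have hreal : Integrable (fun ξ => exp (-(‖ξ‖^2/4 * t)) * ‖S ξ‖^2) (volume : Measure V) := by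
    have h1 := hint.integral_prod_left
    exact (h1.congr (ae_of_all _ fun ξ => hI ξ)).re
  set c : ℝ := (2 * π) ^ (-(n : ℝ) / 2) with hc
  have hc0 : 0 < c := by positivity
  calc _ = ENNReal.ofReal (c^2) * ∫⁻ ξ, ENNReal.ofReal (exp (-(‖ξ‖^2/4 * t)) * ‖S ξ‖^2) := by
        rw [← lintegral_const_mul' _ _ (by simp)]
        congr 1; ext ξ
        rw [← ENNReal.ofReal_mul (by positivity), ← ENNReal.ofReal_mul (by positivity)]
        congr 1
        rw [show fourierTr (⇑f) ξ = (c:ℂ) * S ξ from rfl, norm_mul, Complex.norm_real, norm_of_nonneg hc0.le]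
        ring
    _ = ENNReal.ofReal (c^2) * ENNReal.ofReal (∫ ξ, exp (-(‖ξ‖^2/4 * t)) * ‖S ξ‖^2) := by
        rw [ofReal_integral_eq_lintegral_ofReal hreal]
        filter_upwards with ξ
        simp only [Pi.zero_apply]; positivity
    _ = ENNReal.ofReal (c^2) * ‖∫ ξ, ∫ p, F ξ p‖ₑ := by
        simp_rw [hI]
        rw [integral_complex_ofReal, ← ofReal_norm, Complex.norm_real, norm_of_nonneg]
        positivity
    _ = ENNReal.ofReal (c^2) * ‖∫ p, ∫ ξ, F ξ p‖ₑ := by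
        rw [integral_integral_swap]
        exact hint
    _ ≤ ENNReal.ofReal (c^2) * ∫⁻ p, ‖∫ ξ, F ξ p‖ₑ := by
        gcongr
        exact enorm_integral_le_lintegral_enorm _
    _ = ENNReal.ofReal (c^2) * ∫⁻ p : V × V, ENNReal.ofReal ((4 * π / t) ^ ((n:ℝ)/2)) *
          (‖f p.1‖ₑ * ‖f p.2‖ₑ * ENNReal.ofReal (exp (-(‖p.1-p.2‖^2/t)))) := by
        congr 2; ext p
        rw [hJ p, enorm_mul, enorm_mul, RCLike.enorm_conj,
          ← ofReal_norm (Complex.ofReal _), Complex.norm_real, norm_of_nonneg (by positivity),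
          ENNReal.ofReal_mul (by positivity)]
        ring
    _ = _ := by
        have := f.continuous
        rw [lintegral_const_mul _ (by fun_prop), ← mul_assoc, ← ENNReal.ofReal_mul (by positivity),
          Measure.volume_eq_prod, lintegral_prod _ (by fun_prop)]
        congr 2
        rw [hc, ← rpow_mul_natCast (by positivity), show (-(n : ℝ) / 2 * (2:ℕ)) = (2:ℕ) * (-(n : ℝ) / 2) by ring,
          rpow_natCast_mul (by positivity), show (4 * π / t) = (t / (4 * π))⁻¹ by field_simp,
          inv_rpow (by positivity), ← rpow_neg (by positivity), neg_div,
          ← mul_rpow (by positivity) (by positivity)]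
        congr 1; field_simp; norm_num

lemma pitt_lintegral {n : ℕ} (hn : 1 ≤ n)
    (f : SchwartzMap (EuclideanSpace ℝ (Fin n)) ℂ)
    (l : ℝ) (hl0 : 0 < l) (hln : l < n) :
    ∫⁻ ξ : EuclideanSpace ℝ (Fin n), ENNReal.ofReal (‖ξ‖ ^ (-l) * ‖fourierTr (⇑f) ξ‖ ^ 2) ≤
      ENNReal.ofReal ((2 : ℝ) ^ (-l) * (Real.Gamma ((n - l) / 4) / Real.Gamma ((n + l) / 4)) ^ 2) *
        ∫⁻ x : EuclideanSpace ℝ (Fin n), ENNReal.ofReal (‖x‖ ^ l * ‖f x‖ ^ 2) := by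
  obtain ⟨m, hm⟩ : ∃ m, m = l / 2 := ⟨_, rfl⟩
  obtain ⟨b, hb⟩ : ∃ b, b = (n - l) / 4 := ⟨_, rfl⟩
  obtain ⟨a, ha⟩ : ∃ a, a = (n + l) / 4 := ⟨_, rfl⟩
  have hm0 : 0 < m := by linarith
  have hb0 : 0 < b := by linarith
  have ha0 : 0 < a := by linarith
  have hGa := Gamma_pos_of_pos ha0
  have hGb := Gamma_pos_of_pos hb0
  have hGm := Gamma_pos_of_pos hm0
  rw [← ha, ← hb]
  have hfc := f.continuous
  have hfm : Measurable (fun x => ‖f x‖ₑ) := by fun_prop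
  have : Nonempty (Fin n) := ⟨⟨0, hn⟩⟩
  have h0 := Measure.ae_ne volume (0 : EuclideanSpace ℝ (Fin n))
  have hFm : Measurable (fun ξ => fourierTr (⇑f) ξ) := by
    unfold fourierTr
    apply Measurable.const_mul
    apply StronglyMeasurable.measurable
    apply StronglyMeasurable.integral_prod_right (f := fun ξ x => Complex.exp (-Complex.I * (⟪x, ξ⟫ : ℝ)) * f x)
    apply Continuous.stronglyMeasurable
    simp only [Function.uncurry_def]
    fun_prop
  set K := ENNReal.ofReal (2 ^ (-l) / Gamma m) with hK
  have hKt : K ≠ ⊤ := ENNReal.ofReal_ne_top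
  calc _ = ∫⁻ ξ : EuclideanSpace ℝ (Fin n), K * ∫⁻ t in Set.Ioi (0:ℝ), ENNReal.ofReal (t ^ (m-1)) *
            (ENNReal.ofReal (exp (-(‖ξ‖^2/4 * t))) * ENNReal.ofReal (‖fourierTr (⇑f) ξ‖ ^ 2)) := by
        apply lintegral_congr_ae
        filter_upwards [h0] with ξ hξ
        have hξ : 0 < ‖ξ‖ := norm_pos_iff.2 hξ
        have e1 : ∀ t ∈ Set.Ioi (0:ℝ), ENNReal.ofReal (t ^ (m-1)) *
            (ENNReal.ofReal (exp (-(‖ξ‖^2/4 * t))) * ENNReal.ofReal (‖fourierTr (⇑f) ξ‖ ^ 2)) =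
            ENNReal.ofReal (t ^ (m-1) * exp (-(‖ξ‖^2/4 * t))) * ENNReal.ofReal (‖fourierTr (⇑f) ξ‖ ^ 2) := by
          intro t ht
          have ht : 0 < t := ht
          rw [ENNReal.ofReal_mul (by positivity), mul_assoc]
        rw [setLIntegral_congr_fun measurableSet_Ioi e1, lintegral_mul_const _ (by fun_prop),
          pitt_gamma hm0 (by positivity), ← mul_assoc, ← ENNReal.ofReal_mul (by positivity),
          ← ENNReal.ofReal_mul (by positivity)]
        congr 2
        have e2 : (‖ξ‖^2/4) ^ (-m) = ‖ξ‖ ^ (-l) * 2 ^ l := by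
          rw [show ‖ξ‖^2/4 = (‖ξ‖ / 2)^2 by ring, ← rpow_natCast_mul (by positivity),
            div_rpow (by positivity) (by positivity), show ((2:ℕ):ℝ) * -m = -l by rw [hm]; push_cast; ring,
            rpow_neg (by norm_num : (0:ℝ) ≤ 2)]
          field_simp
        rw [e2, rpow_neg (by norm_num : (0:ℝ) ≤ 2)]
        have : 0 < (2:ℝ) ^ l := by positivity
        field_simp
    _ = K * ∫⁻ t in Set.Ioi (0:ℝ), ENNReal.ofReal (t ^ (m-1)) * ∫⁻ ξ : EuclideanSpace ℝ (Fin n),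
            (ENNReal.ofReal (exp (-(‖ξ‖^2/4 * t))) * ENNReal.ofReal (‖fourierTr (⇑f) ξ‖ ^ 2)) := by
        rw [lintegral_const_mul' _ _ hKt, lintegral_lintegral_swap]
        · congr 2; ext t
          rw [lintegral_const_mul' _ _ ENNReal.ofReal_ne_top]
        · apply Measurable.aemeasurable
          simp only [Function.uncurry_def]
          fun_prop
    _ ≤ K * ∫⁻ t in Set.Ioi (0:ℝ), ENNReal.ofReal (t ^ (m-1)) *
          (ENNReal.ofReal ((π * t) ^ (-((n:ℝ)/2))) *
          ∫⁻ x : EuclideanSpace ℝ (Fin n), ‖f x‖ₑ ^ 2 * ENNReal.ofReal (‖x‖ ^ (2*a)) *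
            ∫⁻ y : EuclideanSpace ℝ (Fin n), ENNReal.ofReal (exp (-(‖x-y‖^2/t))) *
              ENNReal.ofReal (‖y‖ ^ (-(2*a)))) := by
        refine mul_le_mul' le_rfl ?_
        apply lintegral_mono_ae
        filter_upwards [ae_restrict_mem measurableSet_Ioi] with t ht
        refine mul_le_mul' le_rfl ?_
        refine (pitt_heat f ht).trans ?_
        refine mul_le_mul' le_rfl ?_
        exact pitt_schur hn (fun x => ‖f x‖ₑ) (by fun_prop) a t
    _ = K * ∫⁻ x : EuclideanSpace ℝ (Fin n), ‖f x‖ₑ ^ 2 * ENNReal.ofReal (‖x‖ ^ (2*a)) *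
          ∫⁻ t in Set.Ioi (0:ℝ), ENNReal.ofReal (t ^ (m-1)) *
          (ENNReal.ofReal ((π * t) ^ (-((n:ℝ)/2))) *
            ∫⁻ y : EuclideanSpace ℝ (Fin n), ENNReal.ofReal (exp (-(‖x-y‖^2/t))) *
              ENNReal.ofReal (‖y‖ ^ (-(2*a)))) := by
        have hmeas : Measurable (fun p : ℝ × EuclideanSpace ℝ (Fin n) =>
            ∫⁻ y : EuclideanSpace ℝ (Fin n), ENNReal.ofReal (exp (-(‖p.2-y‖^2/p.1))) *
              ENNReal.ofReal (‖y‖ ^ (-(2*a)))) := by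
          apply Measurable.lintegral_prod_right
          fun_prop
        congr 1
        calc _ = ∫⁻ t in Set.Ioi (0:ℝ), ∫⁻ x : EuclideanSpace ℝ (Fin n),
              ‖f x‖ₑ ^ 2 * ENNReal.ofReal (‖x‖ ^ (2*a)) * (ENNReal.ofReal (t ^ (m-1)) *
              (ENNReal.ofReal ((π * t) ^ (-((n:ℝ)/2))) *
                ∫⁻ y : EuclideanSpace ℝ (Fin n), ENNReal.ofReal (exp (-(‖x-y‖^2/t))) *
                  ENNReal.ofReal (‖y‖ ^ (-(2*a))))) := by
              congr 1; ext t
              rw [← lintegral_const_mul' _ _ ENNReal.ofReal_ne_top,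
                ← lintegral_const_mul' _ _ ENNReal.ofReal_ne_top]
              congr 1; ext x
              ring
          _ = ∫⁻ x : EuclideanSpace ℝ (Fin n), ∫⁻ t in Set.Ioi (0:ℝ),
              ‖f x‖ₑ ^ 2 * ENNReal.ofReal (‖x‖ ^ (2*a)) * (ENNReal.ofReal (t ^ (m-1)) *
              (ENNReal.ofReal ((π * t) ^ (-((n:ℝ)/2))) *
                ∫⁻ y : EuclideanSpace ℝ (Fin n), ENNReal.ofReal (exp (-(‖x-y‖^2/t))) *
                  ENNReal.ofReal (‖y‖ ^ (-(2*a))))) := by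
              rw [lintegral_lintegral_swap]
              apply Measurable.aemeasurable
              simp only [Function.uncurry_def]
              refine Measurable.mul (Measurable.mul ((hfm.comp measurable_snd).pow_const 2) (by fun_prop)) (Measurable.mul (by fun_prop)
                (Measurable.mul (by fun_prop) hmeas))
          _ = _ := by
              congr 1; ext x
              rw [lintegral_const_mul' _ _ (by finiteness)]
    _ = K * ∫⁻ x : EuclideanSpace ℝ (Fin n), ENNReal.ofReal (Gamma m * (Gamma b / Gamma a) ^ 2) *
          ENNReal.ofReal (‖x‖ ^ l * ‖f x‖ ^ 2) := by
        congr 1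
        apply lintegral_congr_ae
        filter_upwards [h0] with x hx
        rw [pitt_D hn hb0 hm0 (by linarith) (by linarith) x hx, ← ofReal_norm,
          ← ENNReal.ofReal_pow (by positivity), ← ENNReal.ofReal_mul (by positivity),
          ← ENNReal.ofReal_mul (by positivity), ← ENNReal.ofReal_mul (by positivity)]
        congr 1
        have hx : 0 < ‖x‖ := norm_pos_iff.2 hx
        rw [show l = 2 * a + -(2*b) by linarith, rpow_add hx]
        ring
    _ = _ := by
        rw [lintegral_const_mul' _ _ ENNReal.ofReal_ne_top, ← mul_assoc, hK,
          ← ENNReal.ofReal_mul (by positivity)]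
        congr 2
        field_simp

lemma pitt_integrable {n : ℕ} (f : SchwartzMap (EuclideanSpace ℝ (Fin n)) ℂ) (l : ℝ) (hl0 : 0 ≤ l) :
    Integrable (fun x : EuclideanSpace ℝ (Fin n) => ‖x‖ ^ l * ‖f x‖ ^ 2) := by
  obtain ⟨C, hC⟩ := f.decay 0 0
  have hC : ∀ x, ‖f x‖ ≤ C := by simpa using hC.2
  have h1 := (f.integrable_pow_mul volume ⌈l⌉₊).add (f.integrable_pow_mul volume 0)
  refine (h1.const_mul C).mono ?_ (ae_of_all _ fun x => ?_)
  · have := f.continuous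
    apply Measurable.aestronglyMeasurable
    fun_prop
  · have hC0 : 0 ≤ C := (norm_nonneg _).trans (hC x)
    have e : ‖x‖ ^ l ≤ ‖x‖ ^ ⌈l⌉₊ + 1 := by
      rcases le_total ‖x‖ 1 with h | h
      · have := rpow_le_one (norm_nonneg x) h hl0
        have : 0 ≤ ‖x‖ ^ ⌈l⌉₊ := by positivity
        linarith
      · have := rpow_le_rpow_of_exponent_le h (Nat.le_ceil l)
        rw [rpow_natCast] at this
        linarith
    rw [norm_of_nonneg (by positivity), norm_of_nonneg (by simp; positivity)]
    simp only [Pi.add_apply, pow_zero, one_mul]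
    calc ‖x‖ ^ l * ‖f x‖ ^ 2 ≤ (‖x‖ ^ ⌈l⌉₊ + 1) * (‖f x‖ * C) := by
          rw [sq]; gcongr; exact hC x
      _ = _ := by ring

lemma pitt_plancherel {n : ℕ} (f : SchwartzMap (EuclideanSpace ℝ (Fin n)) ℂ) :
    ∫ ξ : EuclideanSpace ℝ (Fin n), ‖fourierTr (⇑f) ξ‖ ^ 2 =
      ∫ x : EuclideanSpace ℝ (Fin n), ‖f x‖ ^ 2 := by
  have e : ∀ ξ : EuclideanSpace ℝ (Fin n), ‖fourierTr (⇑f) ξ‖ ^ 2 =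
      ((2 * π) ^ n)⁻¹ * ‖(FourierTransform.fourier f) ((2 * π)⁻¹ • ξ)‖ ^ 2 := by
    intro ξ
    rw [SchwartzMap.fourier_coe, Real.fourier_eq', fourierTr, norm_mul, mul_pow, Complex.norm_real,
      norm_of_nonneg (by positivity), ← rpow_mul_natCast (by positivity)]
    congr 1
    · rw [← rpow_natCast, ← rpow_neg (by positivity)]
      congr 1; push_cast; ring
    · congr 4; ext x
      rw [smul_eq_mul, inner_smul_right]
      congr 2
      have : (π : ℂ) ≠ 0 := by exact_mod_cast pi_ne_zero
      push_cast
      field_simp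
  simp_rw [e]
  rw [integral_const_mul, Measure.integral_comp_inv_smul_of_nonneg volume
    (fun ξ => ‖(FourierTransform.fourier f) ξ‖ ^ 2) (by positivity), SchwartzMap.integral_norm_sq_fourier]
  simp only [finrank_euclideanSpace, Fintype.card_fin, smul_eq_mul]
  field_simp

/-- Pitt's inequality. -/
theorem pitt_inequality {n : ℕ} (hn : 1 ≤ n)
    (f : SchwartzMap (EuclideanSpace ℝ (Fin n)) ℂ)
    (l : ℝ) (hl0 : 0 ≤ l) (hln : l < n) :
    ∫ ξ : EuclideanSpace ℝ (Fin n), ‖ξ‖ ^ (-l) * ‖fourierTr (⇑f) ξ‖ ^ 2 ≤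
      (2 : ℝ) ^ (-l) * (Real.Gamma ((n - l) / 4) / Real.Gamma ((n + l) / 4)) ^ 2 *
        ∫ x : EuclideanSpace ℝ (Fin n), ‖x‖ ^ l * ‖f x‖ ^ 2 := by
  rcases hl0.eq_or_lt with rfl | hl
  · have : Gamma ((n:ℝ) / 4) ≠ 0 := (Gamma_pos_of_pos (by positivity)).ne'
    simp [pitt_plancherel, this]
  · have h := pitt_lintegral hn f l hl hln
    have hi := pitt_integrable f l hl0
    rw [← ofReal_integral_eq_lintegral_ofReal hi (ae_of_all _ fun x => by
      simp only [Pi.zero_apply]; positivity), ← ENNReal.ofReal_mul (by positivity)] at h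
    have hpos : 0 ≤ ∫ x : EuclideanSpace ℝ (Fin n), ‖x‖ ^ l * ‖f x‖ ^ 2 :=
      integral_nonneg fun x => by simp only [Pi.zero_apply]; positivity
    by_cases hint : Integrable (fun ξ : EuclideanSpace ℝ (Fin n) => ‖ξ‖ ^ (-l) * ‖fourierTr (⇑f) ξ‖ ^ 2)
    · rw [← ofReal_integral_eq_lintegral_ofReal hint (ae_of_all _ fun x => by
        simp only [Pi.zero_apply]; positivity)] at h
      exact (ENNReal.ofReal_le_ofReal_iff (by positivity)).1 h
    · rw [integral_undef hint]
      positivity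
end

section
/- Let n ≥ 1 and let f ∈ 𝒮(ℝⁿ, ℂ) be a Schwartz function, with Fourier transform normalized as f̂(ξ) = (2π)^{-n/2} ∫_{ℝⁿ} e^{-i⟨x,ξ⟩} f(x) dx. Then the logarithmic uncertainty principle holds: ∫_{ℝⁿ} ln|x| · |f(x)|² dx + ∫_{ℝⁿ} ln|ξ| · |f̂(ξ)|² dξ ≥ (Γ'(n/4)/Γ(n/4) + ln 2) · ‖f‖₂², where Γ is the real Gamma function, Γ' its derivative, and ‖f‖₂² = ∫_{ℝⁿ} |f(x)|² dx. -/
open MeasureTheory Real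
open scoped RealInnerProductSpace

open scoped ENNReal


lemma gammaL {c r : ℝ} (hc : 0 < c) (hr : 0 < r) :
    ∫⁻ t in Set.Ioi (0:ℝ), ENNReal.ofReal (t ^ (c - 1) * rexp (-(r * t))) =
      ENNReal.ofReal ((1 / r) ^ c * Gamma c) := by
  rw [← integral_rpow_mul_exp_neg_mul_Ioi hc hr, ofReal_integral_eq_lintegral_ofReal]
  · by_contra h
    have := integral_rpow_mul_exp_neg_mul_Ioi hc hr
    rw [integral_undef h] at this
    have h2 : 0 < (1 / r) ^ c * Gamma c := mul_pos (by positivity) (Gamma_pos_of_pos hc)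
    linarith
  · filter_upwards [ae_restrict_mem measurableSet_Ioi] with t ht
    have : (0:ℝ) < t := ht
    positivity

lemma scaleL {c : ℝ} (hc : 0 < c) (F : ℝ → ℝ≥0∞) :
    ∫⁻ t in Set.Ioi (0:ℝ), F (c * t) =
      ENNReal.ofReal c⁻¹ * ∫⁻ t in Set.Ioi (0:ℝ), F t := by
  have himg : (fun t : ℝ => c * t) '' Set.Ioi 0 = Set.Ioi 0 := by
    rw [Set.image_mul_left_Ioi hc]; simp
  have := lintegral_image_eq_lintegral_abs_deriv_mul (s := Set.Ioi (0:ℝ)) (f := fun t => c * t)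
    (f' := fun _ => c) measurableSet_Ioi
    (fun x _ => by simpa using ((hasDerivAt_id x).const_mul c).hasDerivWithinAt)
    (fun x _ y _ h => by simpa [hc.ne'] using h) F
  rw [himg] at this
  rw [this, lintegral_const_mul' _ _ ENNReal.ofReal_ne_top, ← mul_assoc, ← ENNReal.ofReal_mul (by positivity),
    abs_of_pos hc, inv_mul_cancel₀ hc.ne']
  simp

lemma betaL {ε a : ℝ} (he : 0 < ε) (ha : 0 < a) :
    ∫⁻ v in Set.Ioi (0:ℝ), ENNReal.ofReal (v ^ (ε - 1) * (1 + v) ^ (-(a + ε))) =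
      ENNReal.ofReal (Gamma ε * Gamma a / Gamma (a + ε)) := by
  have hG : 0 < Gamma (a + ε) := Gamma_pos_of_pos (by positivity)
  have hG0 : ENNReal.ofReal (Gamma (a + ε)) ≠ 0 := by simpa using hG
  rw [← ENNReal.mul_right_inj hG0 ENNReal.ofReal_ne_top,
    ← ENNReal.ofReal_mul hG.le, mul_div_cancel₀ _ hG.ne',
    ← lintegral_const_mul' _ _ ENNReal.ofReal_ne_top]
  have h1 : ∀ v ∈ Set.Ioi (0:ℝ), ENNReal.ofReal (Gamma (a + ε)) *
      ENNReal.ofReal (v ^ (ε - 1) * (1 + v) ^ (-(a + ε))) =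
      ∫⁻ p in Set.Ioi (0:ℝ), ENNReal.ofReal (v ^ (ε - 1)) *
        ENNReal.ofReal (p ^ (a + ε - 1) * rexp (-((1 + v) * p))) := by
    intro v hv
    have hv : (0:ℝ) < v := hv
    rw [lintegral_const_mul' _ _ ENNReal.ofReal_ne_top, gammaL (by positivity) (by positivity),
      ← ENNReal.ofReal_mul (by positivity), ← ENNReal.ofReal_mul (by positivity)]
    congr 1
    rw [one_div, inv_rpow (by positivity), rpow_neg (by positivity)]
    ring
  rw [setLIntegral_congr_fun measurableSet_Ioi h1, lintegral_lintegral_swap]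
  swap
  · refine Measurable.aemeasurable ?_
    simp only [Function.uncurry_def]
    fun_prop
  have h2 : ∀ p ∈ Set.Ioi (0:ℝ), ∫⁻ v in Set.Ioi (0:ℝ), ENNReal.ofReal (v ^ (ε - 1)) *
        ENNReal.ofReal (p ^ (a + ε - 1) * rexp (-((1 + v) * p))) =
      ENNReal.ofReal (Gamma ε) * ENNReal.ofReal (p ^ (a - 1) * rexp (-(1 * p))) := by
    intro p hp
    have hp : (0:ℝ) < p := hp
    have : ∀ v ∈ Set.Ioi (0:ℝ), ENNReal.ofReal (v ^ (ε - 1)) *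
        ENNReal.ofReal (p ^ (a + ε - 1) * rexp (-((1 + v) * p))) =
        ENNReal.ofReal (p ^ (a + ε - 1) * rexp (-p)) *
        ENNReal.ofReal (v ^ (ε - 1) * rexp (-(p * v))) := by
      intro v hv
      have hv : (0:ℝ) < v := hv
      rw [← ENNReal.ofReal_mul (by positivity), ← ENNReal.ofReal_mul (by positivity)]
      congr 1
      rw [show -((1 + v) * p) = -p + -(p * v) by ring, Real.exp_add]
      ring
    rw [setLIntegral_congr_fun measurableSet_Ioi this,
      lintegral_const_mul' _ _ ENNReal.ofReal_ne_top, gammaL he hp,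
      ← ENNReal.ofReal_mul (by positivity), ← ENNReal.ofReal_mul (Gamma_pos_of_pos he).le]
    congr 1
    rw [one_div, inv_rpow hp.le, show a + ε - 1 = (a - 1) + ε by ring, rpow_add hp, one_mul]
    have : p ^ ε ≠ 0 := (rpow_pos_of_pos hp _).ne'
    field_simp
  rw [setLIntegral_congr_fun measurableSet_Ioi h2,
    lintegral_const_mul' _ _ ENNReal.ofReal_ne_top, gammaL ha one_pos,
    ← ENNReal.ofReal_mul (Gamma_pos_of_pos he).le]
  simp

lemma stL {ε a r : ℝ} (he : 0 < ε) (hea : ε < a) (hr : 0 < r) :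
    ∫⁻ t in Set.Ioi (0:ℝ), ∫⁻ s in Set.Ioi (0:ℝ),
      ENNReal.ofReal (t ^ (ε - 1) * (s ^ (a - 1) *
        ((1 + 4 * s * t) ^ (-(2 * a)) * rexp (-(s * r / (1 + 4 * s * t)))))) =
      ENNReal.ofReal (4 ^ (-ε) * Gamma (a - ε) * r ^ (ε - a) * (Gamma ε * Gamma a / Gamma (a + ε))) := by
  have ha : 0 < a := he.trans hea
  rw [lintegral_lintegral_swap]
  swap
  · refine Measurable.aemeasurable ?_
    simp only [Function.uncurry_def]
    fun_prop
  have h1 : ∀ s ∈ Set.Ioi (0:ℝ), ∫⁻ t in Set.Ioi (0:ℝ),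
      ENNReal.ofReal (t ^ (ε - 1) * (s ^ (a - 1) *
        ((1 + 4 * s * t) ^ (-(2 * a)) * rexp (-(s * r / (1 + 4 * s * t)))))) =
      ∫⁻ v in Set.Ioi (0:ℝ), ENNReal.ofReal (4 ^ (-ε) * v ^ (ε - 1) * (1 + v) ^ (-(2 * a))) *
        ENNReal.ofReal (s ^ (a - ε - 1) * rexp (-(r / (1 + v) * s))) := by
    intro s hs
    have hs : (0:ℝ) < s := hs
    have hc : 0 < 4 * s := by positivity
    have h := scaleL hc (fun v => ENNReal.ofReal (4 * s) *
        (ENNReal.ofReal (4 ^ (-ε) * v ^ (ε - 1) * (1 + v) ^ (-(2 * a))) *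
        ENNReal.ofReal (s ^ (a - ε - 1) * rexp (-(r / (1 + v) * s)))))
    conv_rhs at h =>
      rw [lintegral_const_mul' _ _ ENNReal.ofReal_ne_top, ← mul_assoc,
        ← ENNReal.ofReal_mul (by positivity), inv_mul_cancel₀ hc.ne', ENNReal.ofReal_one, one_mul]
    rw [← h]
    refine setLIntegral_congr_fun measurableSet_Ioi fun t ht => ?_
    have ht : (0:ℝ) < t := ht
    rw [← ENNReal.ofReal_mul (by positivity), ← ENNReal.ofReal_mul (by positivity)]
    congr 1
    rw [show s * r / (1 + 4 * s * t) = r / (1 + 4 * s * t) * s by ring,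
      mul_rpow hc.le ht.le, mul_rpow (by norm_num) hs.le, rpow_neg (by norm_num) ε,
      show a - ε - 1 = (a - 1) + -ε by ring, rpow_add hs, rpow_neg hs.le ε,
      rpow_sub_one (by norm_num : (4:ℝ) ≠ 0) ε, rpow_sub_one hs.ne' ε]
    have h1 : (4:ℝ) ^ ε ≠ 0 := by positivity
    have h2 : s ^ ε ≠ 0 := by positivity
    field_simp
  rw [setLIntegral_congr_fun measurableSet_Ioi h1, lintegral_lintegral_swap]
  swap
  · refine Measurable.aemeasurable ?_
    simp only [Function.uncurry_def]
    fun_prop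
  have h2 : ∀ v ∈ Set.Ioi (0:ℝ), ∫⁻ s in Set.Ioi (0:ℝ),
      ENNReal.ofReal (4 ^ (-ε) * v ^ (ε - 1) * (1 + v) ^ (-(2 * a))) *
        ENNReal.ofReal (s ^ (a - ε - 1) * rexp (-(r / (1 + v) * s))) =
      ENNReal.ofReal (4 ^ (-ε) * Gamma (a - ε) * r ^ (ε - a)) *
        ENNReal.ofReal (v ^ (ε - 1) * (1 + v) ^ (-(a + ε))) := by
    intro v hv
    have hv : (0:ℝ) < v := hv
    have hG : 0 < Gamma (a - ε) := Gamma_pos_of_pos (by linarith)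
    rw [lintegral_const_mul' _ _ ENNReal.ofReal_ne_top, gammaL (by linarith) (by positivity),
      ← ENNReal.ofReal_mul (by positivity), ← ENNReal.ofReal_mul (by positivity)]
    congr 1
    rw [one_div_div, div_rpow (by positivity) hr.le, show -(a + ε) = -(2 * a) + (a - ε) by ring,
      rpow_add (by positivity), show ε - a = -(a - ε) by ring, rpow_neg hr.le]
    ring
  have hG : 0 < Gamma (a - ε) := Gamma_pos_of_pos (by linarith)
  rw [setLIntegral_congr_fun measurableSet_Ioi h2,
    lintegral_const_mul' _ _ ENNReal.ofReal_ne_top, betaL he ha, ← ENNReal.ofReal_mul (by positivity)]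
lemma gaussL {n : ℕ} {b : ℝ} (hb : 0 < b) :
    ∫⁻ v : EuclideanSpace ℝ (Fin n), ENNReal.ofReal (rexp (-b * ‖v‖ ^ 2)) =
      ENNReal.ofReal ((π / b) ^ ((n : ℝ) / 2)) := by
  have h := GaussianFourier.integral_rexp_neg_mul_sq_norm (V := EuclideanSpace ℝ (Fin n)) hb
  simp only [finrank_euclideanSpace, Fintype.card_fin] at h
  rw [← h, ofReal_integral_eq_lintegral_ofReal]
  · by_contra h'
    rw [integral_undef h'] at h
    have h2 : 0 < (π / b) ^ ((n : ℝ) / 2) := by positivity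
    linarith
  · filter_upwards with t
    positivity

lemma convL {n : ℕ} {s t : ℝ} (hs : 0 < s) (ht : 0 < t) (x : EuclideanSpace ℝ (Fin n)) :
    ∫⁻ y : EuclideanSpace ℝ (Fin n), ENNReal.ofReal
      ((4 * π * t) ^ (-(n : ℝ) / 2) * rexp (-(‖x - y‖ ^ 2 / (4 * t))) * rexp (-(‖y‖ ^ 2 * s))) =
    ENNReal.ofReal ((1 + 4 * s * t) ^ (-(n : ℝ) / 2) *
      rexp (-(s * ‖x‖ ^ 2 / (1 + 4 * s * t)))) := by
  set D := 1 + 4 * s * t with hD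
  have hDpos : 0 < D := by positivity
  set b := D / (4 * t) with hb
  have hbpos : 0 < b := by positivity
  have h1 : ∀ y : EuclideanSpace ℝ (Fin n), ENNReal.ofReal
      ((4 * π * t) ^ (-(n : ℝ) / 2) * rexp (-(‖x - y‖ ^ 2 / (4 * t))) * rexp (-(‖y‖ ^ 2 * s))) =
      ENNReal.ofReal ((4 * π * t) ^ (-(n : ℝ) / 2) * rexp (-(s * ‖x‖ ^ 2 / D))) *
      ENNReal.ofReal (rexp (-b * ‖y - (D⁻¹) • x‖ ^ 2)) := by
    intro y
    rw [← ENNReal.ofReal_mul (by positivity), mul_assoc (_ ^ _), mul_assoc (_ ^ _), ← Real.exp_add, ← Real.exp_add]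
    congr 3
    rw [norm_sub_sq_real, norm_sub_sq_real, inner_smul_right, norm_smul, real_inner_comm y x,
      Real.norm_of_nonneg (by positivity), hb]
    field_simp
    rw [hD]
    ring
  simp_rw [h1]
  rw [lintegral_const_mul' _ _ ENNReal.ofReal_ne_top,
    lintegral_sub_right_eq_self (fun y => ENNReal.ofReal (rexp (-b * ‖y‖ ^ 2))), gaussL hbpos,
    ← ENNReal.ofReal_mul (by positivity)]
  congr 1
  rw [hb, show π / (D / (4 * t)) = (4 * π * t) / D by field_simp,
    div_rpow (by positivity) hDpos.le, neg_div, rpow_neg (by positivity), rpow_neg hDpos.le]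
  have : (4 * π * t) ^ ((n:ℝ) / 2) ≠ 0 := by positivity
  field_simp

lemma innerGauss {n : ℕ} {t : ℝ} (ht : 0 < t) (w : EuclideanSpace ℝ (Fin n)) :
    ∫ ξ : EuclideanSpace ℝ (Fin n), Complex.exp (-(t : ℂ) * ‖ξ‖ ^ 2 + (-Complex.I) * (⟪w, ξ⟫ : ℝ)) =
      (((π / t) ^ ((n : ℝ) / 2) * rexp (-(‖w‖ ^ 2 / (4 * t))) : ℝ) : ℂ) := by
  rw [GaussianFourier.integral_cexp_neg_mul_sq_norm_add (by simpa using ht)]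
  simp only [finrank_euclideanSpace, Fintype.card_fin]
  rw [Complex.ofReal_mul, Complex.ofReal_cpow (by positivity)]
  push_cast
  congr 2
  rw [neg_sq, Complex.I_sq]
  ring

lemma fourierBound {n : ℕ} (f : SchwartzMap (EuclideanSpace ℝ (Fin n)) ℂ) {t : ℝ} (ht : 0 < t) :
    ∫⁻ ξ, ENNReal.ofReal (rexp (-(‖ξ‖ ^ 2 * t)) * ‖fourierTr (⇑f) ξ‖ ^ 2) ≤
    ∫⁻ x, ∫⁻ y, ENNReal.ofReal ((4 * π * t) ^ (-(n : ℝ) / 2) *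
      rexp (-(‖x - y‖ ^ 2 / (4 * t))) * (‖f x‖ * ‖f y‖)) := by
  have hfint : Integrable (⇑f) := f.integrable
  set V := EuclideanSpace ℝ (Fin n)
  set C : ℝ := (2 * π) ^ (-(n : ℝ) / 2) with hC
  let H : V → V × V → ℂ := fun ξ p => (C : ℂ) ^ 2 *
    Complex.exp (-(t : ℂ) * ‖ξ‖ ^ 2 + (-Complex.I) * (⟪p.1 - p.2, ξ⟫ : ℝ)) * 
      (f p.1 * (starRingEnd ℂ) (f p.2))
  have hgint : Integrable (fun p : V × V => f p.1 * (starRingEnd ℂ) (f p.2)) (volume.prod volume) := by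
    refine Integrable.mul_prod (f := ⇑f) (g := fun y => (starRingEnd ℂ) (f y)) hfint ?_
    refine hfint.norm.mono' ?_ ?_
    · exact (Complex.continuous_conj.comp f.continuous).aestronglyMeasurable
    · filter_upwards with y; simp
  have hGint : Integrable (fun ξ : V => rexp (-t * ‖ξ‖ ^ 2)) := by
    have := (GaussianFourier.integrable_cexp_neg_mul_sq_norm_add (V := V) (b := (t:ℂ))
      (by simpa using ht) 0 0).norm
    refine this.congr ?_
    filter_upwards with ξ
    rw [Complex.norm_exp]
    congr 1
    simp [← Complex.ofReal_pow]
  have hnorm : ∀ ξ p, ‖H ξ p‖ = C ^ 2 * rexp (-t * ‖ξ‖ ^ 2) * (‖f p.1 * (starRingEnd ℂ) (f p.2)‖) := by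
    intro ξ p
    simp only [H, norm_mul, Complex.norm_exp]
    congr 2
    · simp
    · congr 1
      simp [← Complex.ofReal_pow]
  have hHint : Integrable (Function.uncurry H) (volume.prod (volume.prod volume)) := by
    have h1 := (Integrable.mul_prod hGint hgint.norm).const_mul (C ^ 2)
    refine h1.mono' ?_ ?_
    · refine Continuous.aestronglyMeasurable ?_
      have hf := f.continuous
      simp only [H, Function.uncurry_def]
      fun_prop
    · filter_upwards with z
      simp only [Function.uncurry_def]
      rw [hnorm, mul_assoc]
  have hprod : ∀ ξ, ((rexp (-(‖ξ‖ ^ 2 * t)) * ‖fourierTr (⇑f) ξ‖ ^ 2 : ℝ) : ℂ) =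
      ∫ p, H ξ p ∂(volume.prod volume) := by
    intro ξ
    have h1 : ∀ p : V × V, H ξ p = ((C : ℂ) ^ 2 * rexp (-(‖ξ‖ ^ 2 * t))) *
        ((Complex.exp (-Complex.I * (⟪p.1, ξ⟫ : ℝ)) * f p.1) *
          (starRingEnd ℂ) (Complex.exp (-Complex.I * (⟪p.2, ξ⟫ : ℝ)) * f p.2)) := by
      intro p
      simp only [H, map_mul, ← Complex.exp_conj, inner_sub_left]
      push_cast
      rw [show -(t:ℂ) * ‖ξ‖ ^ 2 + -Complex.I * ((⟪p.1, ξ⟫ : ℝ) - (⟪p.2, ξ⟫ : ℝ)) =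
        -(‖ξ‖ ^ 2 * t) + (-Complex.I * (⟪p.1, ξ⟫ : ℝ) + Complex.I * (⟪p.2, ξ⟫ : ℝ)) by ring,
        Complex.exp_add, Complex.exp_add]
      simp
      ring
    simp_rw [h1]
    rw [integral_const_mul, integral_prod_mul
      (f := fun x => Complex.exp (-Complex.I * (⟪x, ξ⟫ : ℝ)) * f x)
      (g := fun x => (starRingEnd ℂ) (Complex.exp (-Complex.I * (⟪x, ξ⟫ : ℝ)) * f x)),
      integral_conj, Complex.mul_conj, Complex.normSq_eq_norm_sq]
    simp only [fourierTr, norm_mul]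
    rw [Complex.norm_of_nonneg (by positivity)]
    push_cast
    ring
  have hA : Integrable (fun ξ => rexp (-(‖ξ‖ ^ 2 * t)) * ‖fourierTr (⇑f) ξ‖ ^ 2) := by
    have h := hHint.integral_prod_left
    simp only [Function.uncurry_def, ← hprod] at h
    exact h.re
  have hA0 : ∀ ξ, 0 ≤ rexp (-(‖ξ‖ ^ 2 * t)) * ‖fourierTr (⇑f) ξ‖ ^ 2 := fun ξ => by positivity
  rw [← ofReal_integral_eq_lintegral_ofReal hA (Filter.Eventually.of_forall hA0),
    ← Real.enorm_of_nonneg (integral_nonneg hA0)]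
  have hswap : ((∫ ξ, rexp (-(‖ξ‖ ^ 2 * t)) * ‖fourierTr (⇑f) ξ‖ ^ 2 : ℝ) : ℂ) =
      ∫ p, ∫ ξ, H ξ p ∂volume ∂(volume.prod volume) := by
    rw [← integral_complex_ofReal]
    simp_rw [hprod]
    exact integral_integral_swap hHint
  have hen : ‖(∫ ξ, rexp (-(‖ξ‖ ^ 2 * t)) * ‖fourierTr (⇑f) ξ‖ ^ 2 : ℝ)‖ₑ =
      ‖∫ p, ∫ ξ, H ξ p ∂volume ∂(volume.prod volume)‖ₑ := by
    rw [← hswap]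
    simp [enorm_eq_nnnorm]
  rw [hen]
  refine (enorm_integral_le_lintegral_enorm _).trans ?_
  have hH : ∀ p : V × V, ‖∫ ξ, H ξ p‖ₑ = ENNReal.ofReal ((4 * π * t) ^ (-(n : ℝ) / 2) *
      rexp (-(‖p.1 - p.2‖ ^ 2 / (4 * t))) * (‖f p.1‖ * ‖f p.2‖)) := by
    intro p
    simp only [H]
    rw [integral_mul_const, integral_const_mul, innerGauss ht, ← ofReal_norm]
    congr 1
    simp only [norm_mul, norm_pow, Complex.norm_real, RCLike.norm_conj]
    rw [Real.norm_of_nonneg (by positivity : 0 ≤ C), Real.norm_of_nonneg (by positivity),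
      Real.norm_of_nonneg (by positivity), ← mul_assoc (C ^ 2)]
    congr 2
    rw [hC, ← Real.rpow_natCast, ← Real.rpow_mul (by positivity),
      show (4 * π * t) = ((2 * π) ^ 2) * (π / t)⁻¹ by field_simp; ring,
      mul_rpow (by positivity : 0 ≤ (2 * π) ^ 2) (by positivity), inv_rpow (by positivity), neg_div,
      rpow_neg (by positivity : 0 ≤ π / t), inv_inv, ← Real.rpow_natCast (2 * π), ← Real.rpow_mul (by positivity)]
    congr 2
    push_cast
    ring
  simp_rw [hH]
  rw [lintegral_prod]
  refine Measurable.aemeasurable ?_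
  have hf := f.continuous.measurable
  fun_prop

lemma ae_ne_zero_E {n : ℕ} (hn : 1 ≤ n) : ∀ᵐ x : EuclideanSpace ℝ (Fin n), x ≠ 0 := by
  have : NeZero n := ⟨by omega⟩
  have : Nontrivial (EuclideanSpace ℝ (Fin n)) := inferInstance
  exact (measure_eq_zero_iff_ae_notMem.mp (measure_singleton (0 : EuclideanSpace ℝ (Fin n))))

lemma normGamma {n : ℕ} {c : ℝ} (hc : 0 < c) {x : EuclideanSpace ℝ (Fin n)} (hx : x ≠ 0) :
    ENNReal.ofReal (Gamma c) * ENNReal.ofReal (‖x‖ ^ (-(2 * c))) =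
      ∫⁻ t in Set.Ioi (0:ℝ), ENNReal.ofReal (t ^ (c - 1) * rexp (-(‖x‖ ^ 2 * t))) := by
  have hx' : 0 < ‖x‖ := norm_pos_iff.mpr hx
  rw [gammaL hc (by positivity), ← ENNReal.ofReal_mul (Gamma_pos_of_pos hc).le]
  congr 1
  rw [one_div, inv_rpow (by positivity), ← Real.rpow_natCast, ← Real.rpow_mul hx'.le,
    rpow_neg hx'.le]
  push_cast
  ring

lemma schurL {n : ℕ} (hn : 1 ≤ n) (f : SchwartzMap (EuclideanSpace ℝ (Fin n)) ℂ)
    (k : EuclideanSpace ℝ (Fin n) → EuclideanSpace ℝ (Fin n) → ℝ) (hk : ∀ x y, 0 ≤ k x y)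
    (hsymm : ∀ x y, k x y = k y x) (hkm : Measurable (Function.uncurry k)) (b : ℝ) :
    ∫⁻ x, ∫⁻ y, ENNReal.ofReal (k x y * (‖f x‖ * ‖f y‖)) ≤
    ∫⁻ x, ∫⁻ y, ENNReal.ofReal (k x y * (‖f x‖ ^ 2 * ‖x‖ ^ b * ‖y‖ ^ (-b))) := by
  have hf := f.continuous.measurable
  have hkm' : Measurable (fun p : EuclideanSpace ℝ (Fin n) × EuclideanSpace ℝ (Fin n) => k p.1 p.2) := hkm
  set J := ∫⁻ x, ∫⁻ y, ENNReal.ofReal (k x y * (‖f x‖ ^ 2 * ‖x‖ ^ b * ‖y‖ ^ (-b))) with hJ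
  have hJm : Measurable (fun p : EuclideanSpace ℝ (Fin n) × EuclideanSpace ℝ (Fin n) =>
    ENNReal.ofReal (k p.1 p.2 * (‖f p.1‖ ^ 2 * ‖p.1‖ ^ b * ‖p.2‖ ^ (-b)))) := by fun_prop
  have hJ2 : J = ∫⁻ x, ∫⁻ y, ENNReal.ofReal (k x y * (‖f y‖ ^ 2 * ‖y‖ ^ b * ‖x‖ ^ (-b))) := by
    rw [hJ, lintegral_lintegral_swap hJm.aemeasurable]
    refine lintegral_congr fun x => lintegral_congr fun y => ?_
    rw [hsymm]
  have h2 : 2 * ∫⁻ x, ∫⁻ y, ENNReal.ofReal (k x y * (‖f x‖ * ‖f y‖)) ≤ 2 * J := by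
    calc 2 * ∫⁻ x, ∫⁻ y, ENNReal.ofReal (k x y * (‖f x‖ * ‖f y‖))
        = ∫⁻ x, ∫⁻ y, 2 * ENNReal.ofReal (k x y * (‖f x‖ * ‖f y‖)) := by
          rw [← lintegral_const_mul' _ _ (by simp)]
          refine lintegral_congr fun x => ?_
          rw [← lintegral_const_mul' _ _ (by simp)]
      _ ≤ ∫⁻ x, ∫⁻ y, (ENNReal.ofReal (k x y * (‖f x‖ ^ 2 * ‖x‖ ^ b * ‖y‖ ^ (-b))) +
            ENNReal.ofReal (k x y * (‖f y‖ ^ 2 * ‖y‖ ^ b * ‖x‖ ^ (-b)))) := by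
          refine lintegral_mono_ae ?_
          filter_upwards [ae_ne_zero_E hn] with x hx
          refine lintegral_mono_ae ?_
          filter_upwards [ae_ne_zero_E hn] with y hy
          have hx' : 0 < ‖x‖ := norm_pos_iff.mpr hx
          have hy' : 0 < ‖y‖ := norm_pos_iff.mpr hy
          have hkk := hk x y
          have h22 : ∀ z : ℝ, 2 * ENNReal.ofReal z = ENNReal.ofReal (2 * z) := by
            intro z
            rw [ENNReal.ofReal_mul (by norm_num)]
            simp
          rw [← ENNReal.ofReal_add (by positivity) (by positivity), h22,
            ← mul_add, mul_left_comm]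
          refine ENNReal.ofReal_le_ofReal (mul_le_mul_of_nonneg_left ?_ hkk)
          rw [rpow_neg hx'.le, rpow_neg hy'.le]
          have hX : 0 < ‖x‖ ^ b := by positivity
          have hY : 0 < ‖y‖ ^ b := by positivity
          generalize ‖x‖ ^ b = X at *
          generalize ‖y‖ ^ b = Y at *
          have : ‖f x‖ ^ 2 * X * Y⁻¹ + ‖f y‖ ^ 2 * Y * X⁻¹ - 2 * (‖f x‖ * ‖f y‖) =
            (‖f x‖ * X - ‖f y‖ * Y) ^ 2 * (X⁻¹ * Y⁻¹) := by
            field_simp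
            ring
          have h0 : 0 ≤ (‖f x‖ * X - ‖f y‖ * Y) ^ 2 * (X⁻¹ * Y⁻¹) := by positivity
          linarith
      _ = J + J := by
          conv_rhs => rw [hJ2]
          conv_rhs => lhs; rw [← hJ2, hJ]
          rw [← lintegral_add_left (hJm.lintegral_prod_right')]
          refine lintegral_congr fun x => ?_
          rw [lintegral_add_left]
          exact hJm.comp measurable_prodMk_left
      _ = 2 * J := (two_mul J).symm
  exact (ENNReal.mul_le_mul_iff_right (by simp) (by simp)).mp h2

lemma innerJ {n : ℕ} (hn : 1 ≤ n) {t : ℝ} (ht : 0 < t) (x : EuclideanSpace ℝ (Fin n)) :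
    ENNReal.ofReal (Gamma ((n : ℝ) / 4)) * ∫⁻ y : EuclideanSpace ℝ (Fin n),
      ENNReal.ofReal ((4 * π * t) ^ (-(n : ℝ) / 2) * rexp (-(‖x - y‖ ^ 2 / (4 * t)))) *
        ENNReal.ofReal (‖y‖ ^ (-(2 * ((n : ℝ) / 4)))) =
    ∫⁻ s in Set.Ioi (0:ℝ), ENNReal.ofReal (s ^ ((n : ℝ) / 4 - 1) *
        ((1 + 4 * s * t) ^ (-(2 * ((n : ℝ) / 4))) * rexp (-(s * ‖x‖ ^ 2 / (1 + 4 * s * t))))) := by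
  have ha : 0 < (n : ℝ) / 4 := by
    have : (1 : ℝ) ≤ n := by exact_mod_cast hn
    positivity
  rw [← lintegral_const_mul' _ _ ENNReal.ofReal_ne_top]
  have h1 : ∀ᵐ y : EuclideanSpace ℝ (Fin n), ENNReal.ofReal (Gamma ((n : ℝ) / 4)) *
      (ENNReal.ofReal ((4 * π * t) ^ (-(n : ℝ) / 2) * rexp (-(‖x - y‖ ^ 2 / (4 * t)))) *
        ENNReal.ofReal (‖y‖ ^ (-(2 * ((n : ℝ) / 4))))) =
      ∫⁻ s in Set.Ioi (0:ℝ),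
        ENNReal.ofReal ((4 * π * t) ^ (-(n : ℝ) / 2) * rexp (-(‖x - y‖ ^ 2 / (4 * t)))) *
        ENNReal.ofReal (s ^ ((n : ℝ) / 4 - 1) * rexp (-(‖y‖ ^ 2 * s))) := by
    filter_upwards [ae_ne_zero_E hn] with y hy
    rw [lintegral_const_mul' _ _ ENNReal.ofReal_ne_top, ← normGamma ha hy]
    ring
  rw [lintegral_congr_ae h1, lintegral_lintegral_swap]
  swap
  · refine Measurable.aemeasurable ?_
    simp only [Function.uncurry_def]
    fun_prop
  refine setLIntegral_congr_fun measurableSet_Ioi fun s hs => ?_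
  have hs : (0:ℝ) < s := hs
  rw [ENNReal.ofReal_mul (by positivity), show -(2 * ((n : ℝ) / 4)) = -(n : ℝ) / 2 by ring,
    ← convL hs ht x, ← lintegral_const_mul' _ _ ENNReal.ofReal_ne_top]
  refine lintegral_congr fun y => ?_
  rw [← ENNReal.ofReal_mul (by positivity), ← ENNReal.ofReal_mul (by positivity)]
  congr 1
  ring

lemma pitt {n : ℕ} (hn : 1 ≤ n) (f : SchwartzMap (EuclideanSpace ℝ (Fin n)) ℂ) {ε : ℝ}
    (hm : Measurable (fourierTr (⇑f)))
    (he : 0 < ε) (hea : ε < (n : ℝ) / 4) :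
    ∫⁻ ξ, ENNReal.ofReal (‖ξ‖ ^ (-(2 * ε)) * ‖fourierTr (⇑f) ξ‖ ^ 2) ≤
    ENNReal.ofReal (4 ^ (-ε) * Gamma ((n : ℝ) / 4 - ε) / Gamma ((n : ℝ) / 4 + ε)) *
      ∫⁻ x, ENNReal.ofReal (‖x‖ ^ (2 * ε) * ‖f x‖ ^ 2) := by
  have hf := f.continuous.measurable
  set a : ℝ := (n : ℝ) / 4 with haa
  have ha : 0 < a := he.trans hea
  have hGe : 0 < Gamma ε := Gamma_pos_of_pos he
  have hGa : 0 < Gamma a := Gamma_pos_of_pos ha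
  have hGae : 0 < Gamma (a - ε) := Gamma_pos_of_pos (by linarith)
  have hGae' : 0 < Gamma (a + ε) := Gamma_pos_of_pos (by linarith)
  have hG1 : ENNReal.ofReal (Gamma ε) ≠ 0 := by simpa using hGe
  have hG2 : ENNReal.ofReal (Gamma a) ≠ 0 := by simpa using hGa
  have hstep1 : ENNReal.ofReal (Gamma ε) *
      ∫⁻ ξ, ENNReal.ofReal (‖ξ‖ ^ (-(2 * ε)) * ‖fourierTr (⇑f) ξ‖ ^ 2) =
      ∫⁻ t in Set.Ioi (0:ℝ), ENNReal.ofReal (t ^ (ε - 1)) *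
        ∫⁻ ξ, ENNReal.ofReal (rexp (-(‖ξ‖ ^ 2 * t)) * ‖fourierTr (⇑f) ξ‖ ^ 2) := by
    rw [← lintegral_const_mul' _ _ ENNReal.ofReal_ne_top]
    have h1 : ∀ᵐ ξ : EuclideanSpace ℝ (Fin n), ENNReal.ofReal (Gamma ε) *
        ENNReal.ofReal (‖ξ‖ ^ (-(2 * ε)) * ‖fourierTr (⇑f) ξ‖ ^ 2) =
        ∫⁻ t in Set.Ioi (0:ℝ), ENNReal.ofReal (t ^ (ε - 1)) *
          ENNReal.ofReal (rexp (-(‖ξ‖ ^ 2 * t)) * ‖fourierTr (⇑f) ξ‖ ^ 2) := by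
      filter_upwards [ae_ne_zero_E hn] with ξ hξ
      rw [ENNReal.ofReal_mul (by positivity), ← mul_assoc, normGamma he hξ,
        ← lintegral_mul_const' _ _ ENNReal.ofReal_ne_top]
      refine setLIntegral_congr_fun measurableSet_Ioi fun t ht => ?_
      have ht : (0:ℝ) < t := ht
      rw [← ENNReal.ofReal_mul (by positivity), ← ENNReal.ofReal_mul (by positivity), mul_assoc]
    rw [lintegral_congr_ae h1, lintegral_lintegral_swap]
    swap
    · refine Measurable.aemeasurable ?_
      simp only [Function.uncurry_def]
      fun_prop
    refine lintegral_congr fun t => ?_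
    rw [lintegral_const_mul' _ _ ENNReal.ofReal_ne_top]
  have hstep2 : ∀ t ∈ Set.Ioi (0:ℝ), ENNReal.ofReal (Gamma a) * (ENNReal.ofReal (t ^ (ε - 1)) *
        ∫⁻ ξ, ENNReal.ofReal (rexp (-(‖ξ‖ ^ 2 * t)) * ‖fourierTr (⇑f) ξ‖ ^ 2)) ≤
      ∫⁻ x, ENNReal.ofReal (‖f x‖ ^ 2 * ‖x‖ ^ (2 * a)) *
        ∫⁻ s in Set.Ioi (0:ℝ), ENNReal.ofReal (t ^ (ε - 1) * (s ^ (a - 1) *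
        ((1 + 4 * s * t) ^ (-(2 * a)) * rexp (-(s * ‖x‖ ^ 2 / (1 + 4 * s * t)))))) := by
    intro t ht
    have ht : (0:ℝ) < t := ht
    have h1 := (fourierBound f ht).trans (schurL hn f
      (fun x y => (4 * π * t) ^ (-(n : ℝ) / 2) * rexp (-(‖x - y‖ ^ 2 / (4 * t))))
      (fun x y => by positivity) (fun x y => by rw [norm_sub_rev])
      (by simp only [Function.uncurry_def]; fun_prop) (2 * a))
    beta_reduce at h1
    refine le_trans (mul_le_mul' le_rfl (mul_le_mul' le_rfl h1)) (le_of_eq ?_)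
    rw [mul_left_comm, ← lintegral_const_mul' _ _ ENNReal.ofReal_ne_top,
      ← lintegral_const_mul' _ _ ENNReal.ofReal_ne_top]
    refine lintegral_congr fun x => ?_
    have h2 : ∀ y : EuclideanSpace ℝ (Fin n),
      ENNReal.ofReal ((4 * π * t) ^ (-(n : ℝ) / 2) * rexp (-(‖x - y‖ ^ 2 / (4 * t))) *
        (‖f x‖ ^ 2 * ‖x‖ ^ (2 * a) * ‖y‖ ^ (-(2 * a)))) =
      ENNReal.ofReal (‖f x‖ ^ 2 * ‖x‖ ^ (2 * a)) *
      (ENNReal.ofReal ((4 * π * t) ^ (-(n : ℝ) / 2) * rexp (-(‖x - y‖ ^ 2 / (4 * t)))) *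
        ENNReal.ofReal (‖y‖ ^ (-(2 * a)))) := by
      intro y
      rw [← ENNReal.ofReal_mul (by positivity), ← ENNReal.ofReal_mul (by positivity)]
      congr 1
      ring
    simp_rw [h2]
    rw [lintegral_const_mul' _ _ ENNReal.ofReal_ne_top, mul_left_comm (ENNReal.ofReal (Gamma a)),
      innerJ hn ht x, mul_left_comm, ← lintegral_const_mul' _ _ ENNReal.ofReal_ne_top]
    congr 1
    refine lintegral_congr fun s => ?_
    rw [← ENNReal.ofReal_mul (by positivity)]
  rw [← ENNReal.mul_le_mul_iff_right hG1 ENNReal.ofReal_ne_top, hstep1,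
    ← ENNReal.mul_le_mul_iff_right hG2 ENNReal.ofReal_ne_top,
    ← lintegral_const_mul' _ _ ENNReal.ofReal_ne_top]
  refine (setLIntegral_mono' measurableSet_Ioi hstep2).trans ?_
  rw [lintegral_lintegral_swap]
  swap
  · refine Measurable.aemeasurable ?_
    simp only [Function.uncurry_def]
    refine Measurable.mul (by fun_prop) ?_
    refine Measurable.lintegral_prod_right' (f := fun q : (ℝ × EuclideanSpace ℝ (Fin n)) × ℝ =>
      ENNReal.ofReal (q.1.1 ^ (ε - 1) * (q.2 ^ (a - 1) *
        ((1 + 4 * q.2 * q.1.1) ^ (-(2 * a)) *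
          rexp (-(q.2 * ‖q.1.2‖ ^ 2 / (1 + 4 * q.2 * q.1.1))))))) ?_
    fun_prop
  rw [← mul_assoc, ← mul_assoc, ← ENNReal.ofReal_mul hGa.le, ← ENNReal.ofReal_mul (by positivity),
    ← lintegral_const_mul' _ _ ENNReal.ofReal_ne_top]
  refine lintegral_mono_ae ?_
  filter_upwards [ae_ne_zero_E hn] with x hx
  have hx' : 0 < ‖x‖ := norm_pos_iff.mpr hx
  rw [lintegral_const_mul' _ _ ENNReal.ofReal_ne_top, stL he hea (by positivity),
    ← ENNReal.ofReal_mul (by positivity), ← ENNReal.ofReal_mul (by positivity)]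
  refine ENNReal.ofReal_le_ofReal (le_of_eq ?_)
  rw [← Real.rpow_natCast ‖x‖ 2, ← Real.rpow_mul hx'.le,
    show 2 * ε = 2 * a + ((2 : ℕ) : ℝ) * (ε - a) by push_cast; ring, Real.rpow_add hx']
  ring

lemma ofReal_int_le {α : Type*} [MeasurableSpace α] {μ : Measure α} {h : α → ℝ}
    (hi : Integrable h μ) :
    ENNReal.ofReal (∫ x, h x ∂μ) ≤ ∫⁻ x, ENNReal.ofReal (h x) ∂μ := by
  calc ENNReal.ofReal (∫ x, h x ∂μ) ≤ ENNReal.ofReal (∫ x, max (h x) 0 ∂μ) :=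
        ENNReal.ofReal_le_ofReal (integral_mono hi hi.pos_part fun x => le_max_left _ _)
    _ = ∫⁻ x, ENNReal.ofReal (max (h x) 0) ∂μ :=
        ofReal_integral_eq_lintegral_ofReal hi.pos_part
          (Filter.Eventually.of_forall fun x => le_max_right _ _)
    _ = ∫⁻ x, ENNReal.ofReal (h x) ∂μ := by simp [ENNReal.ofReal_max]

open Filter Topology in
lemma fourierSchwartz {n : ℕ} (f : SchwartzMap (EuclideanSpace ℝ (Fin n)) ℂ) :
    ∃ G : SchwartzMap (EuclideanSpace ℝ (Fin n)) ℂ, (∀ ξ, G ξ = fourierTr (⇑f) ξ) ∧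
      ∫ ξ, ‖G ξ‖ ^ 2 = ∫ x, ‖f x‖ ^ 2 := by
  have h0 : ((2 * π)⁻¹ : ℝ) ≠ 0 := by positivity
  let e : EuclideanSpace ℝ (Fin n) ≃L[ℝ] EuclideanSpace ℝ (Fin n) :=
    (LinearEquiv.smulOfNeZero ℝ _ ((2 * π)⁻¹ : ℝ) h0).toContinuousLinearEquiv
  have he : ∀ ξ, e ξ = ((2 * π)⁻¹ : ℝ) • ξ := fun ξ => rfl
  refine ⟨((((2 * π) ^ (-(n : ℝ) / 2) : ℝ)) : ℂ) •
    SchwartzMap.compCLMOfContinuousLinearEquiv ℂ e (FourierTransform.fourier f), ?_, ?_⟩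
  · intro ξ
    simp only [smul_apply, SchwartzMap.compCLMOfContinuousLinearEquiv_apply,
      Function.comp_apply, he, SchwartzMap.fourier_coe, Real.fourier_eq', smul_eq_mul, fourierTr]
    congr 1
    refine integral_congr_ae (Eventually.of_forall fun x => ?_)
    simp only
    congr 2
    rw [inner_smul_right]
    push_cast
    have : (π : ℂ) ≠ 0 := by exact_mod_cast pi_ne_zero
    field_simp
  · simp only [smul_apply, SchwartzMap.compCLMOfContinuousLinearEquiv_apply,
      Function.comp_apply, he, norm_smul, mul_pow]
    rw [integral_const_mul,
      Measure.integral_comp_smul volume (fun ξ => ‖(FourierTransform.fourier f) ξ‖ ^ 2),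
      SchwartzMap.integral_norm_sq_fourier, smul_eq_mul, ← mul_assoc]
    convert one_mul _
    rw [Complex.norm_real, Real.norm_of_nonneg (by positivity), finrank_euclideanSpace,
      Fintype.card_fin, abs_of_nonneg (by positivity), ← Real.rpow_natCast _ 2,
      ← Real.rpow_mul (by positivity), inv_pow, inv_inv, ← Real.rpow_natCast _ n,
      ← Real.rpow_add (by positivity)]
    convert Real.rpow_zero _
    push_cast
    ring

lemma sqInt {n : ℕ} (g : SchwartzMap (EuclideanSpace ℝ (Fin n)) ℂ) (k : ℕ) :
    Integrable (fun x => ‖x‖ ^ k * ‖g x‖ ^ 2) := by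
  have hb := SchwartzMap.norm_le_seminorm ℝ g
  set M := (SchwartzMap.seminorm ℝ 0 0) g
  refine ((g.integrable_pow_mul volume k).const_mul M).mono' ?_ ?_
  · have := g.continuous
    exact Continuous.aestronglyMeasurable (by fun_prop)
  · filter_upwards with x
    rw [Real.norm_of_nonneg (by positivity)]
    have h1 : ‖x‖ ^ k * ‖g x‖ ^ 2 = ‖g x‖ * (‖x‖ ^ k * ‖g x‖) := by ring
    rw [h1]
    exact mul_le_mul_of_nonneg_right (hb x) (by positivity)

lemma invsqrtInt {n : ℕ} (hn : 1 ≤ n) :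
    IntegrableOn (fun x : EuclideanSpace ℝ (Fin n) => ‖x‖ ^ (-(1/2) : ℝ)) (Metric.ball 0 1) := by
  have : NeZero n := ⟨by omega⟩
  have : Nontrivial (EuclideanSpace ℝ (Fin n)) := inferInstance
  refine (integrableOn_fun_norm_addHaar volume (f := fun r : ℝ => r ^ (-(1/2) : ℝ))).mpr ?_
  have h : IntegrableOn (fun r : ℝ => r ^ (-(1/2) : ℝ)) (Set.Ioo 0 1) :=
    (intervalIntegral.integrableOn_Ioo_rpow_iff one_pos).mpr (by norm_num)
  refine Integrable.mono' h (Measurable.aestronglyMeasurable (by fun_prop)) ?_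
  filter_upwards [ae_restrict_mem measurableSet_Ioo] with r hr
  have hr0 : 0 < r := hr.1
  rw [smul_eq_mul, Real.norm_of_nonneg (by positivity)]
  exact mul_le_of_le_one_left (by positivity) (pow_le_one₀ hr0.le hr.2.le)

lemma logInt {n : ℕ} (hn : 1 ≤ n) (g : SchwartzMap (EuclideanSpace ℝ (Fin n)) ℂ) :
    Integrable (fun x => |Real.log ‖x‖| * (1 + ‖x‖) * ‖g x‖ ^ 2) := by
  have hb := SchwartzMap.norm_le_seminorm ℝ g
  set M := (SchwartzMap.seminorm ℝ 0 0) g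
  have hg := g.continuous.measurable
  have h1 := ((integrable_indicator_iff Metric.isOpen_ball.measurableSet).mpr
    (invsqrtInt hn)).const_mul (4 * M ^ 2)
  have h2 := (sqInt g 2).const_mul 2
  refine (h1.add h2).mono' (Measurable.aestronglyMeasurable (by fun_prop)) ?_
  filter_upwards [ae_ne_zero_E hn] with x hx
  have hx' : 0 < ‖x‖ := norm_pos_iff.mpr hx
  rw [Real.norm_of_nonneg (by positivity)]
  simp only [Pi.add_apply]
  by_cases h : ‖x‖ < 1
  · have hmem : x ∈ Metric.ball (0 : EuclideanSpace ℝ (Fin n)) 1 := by simpa using h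
    rw [Set.indicator_of_mem hmem]
    have hl := (Real.abs_log_mul_self_rpow_lt ‖x‖ (1/2) hx' h.le (by norm_num)).le
    have hl2 : |Real.log ‖x‖| ≤ 2 * ‖x‖ ^ (-(1/2) : ℝ) := by
      rw [abs_mul, abs_of_pos (by positivity : 0 < ‖x‖ ^ (1/2 : ℝ))] at hl
      rw [rpow_neg hx'.le, ← div_eq_mul_inv, le_div_iff₀ (by positivity)]
      linarith
    have hM : ‖g x‖ ^ 2 ≤ M ^ 2 := by gcongr; exact hb x
    have : |Real.log ‖x‖| * (1 + ‖x‖) * ‖g x‖ ^ 2 ≤ (2 * ‖x‖ ^ (-(1/2) : ℝ)) * 2 * M ^ 2 := by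
      gcongr
      linarith
    have h0 : 0 ≤ 2 * (‖x‖ ^ 2 * ‖g x‖ ^ 2) := by positivity
    linarith
  · have hmem : x ∉ Metric.ball (0 : EuclideanSpace ℝ (Fin n)) 1 := by simpa using h
    rw [Set.indicator_of_notMem hmem]
    have h1 : 1 ≤ ‖x‖ := not_lt.mp h
    have hl : |Real.log ‖x‖| ≤ ‖x‖ := by
      rw [abs_of_nonneg (Real.log_nonneg h1)]
      linarith [Real.log_le_sub_one_of_pos hx']
    have : |Real.log ‖x‖| * (1 + ‖x‖) * ‖g x‖ ^ 2 ≤ ‖x‖ * (2 * ‖x‖) * ‖g x‖ ^ 2 := by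
      gcongr
      linarith
    linarith

lemma logInt' {n : ℕ} (hn : 1 ≤ n) (g : SchwartzMap (EuclideanSpace ℝ (Fin n)) ℂ) :
    Integrable (fun x => Real.log ‖x‖ * ‖g x‖ ^ 2) := by
  have hg := g.continuous.measurable
  refine (logInt hn g).mono' (Measurable.aestronglyMeasurable (by fun_prop)) ?_
  filter_upwards with x
  rw [norm_mul, Real.norm_eq_abs, Real.norm_of_nonneg (by positivity : 0 ≤ ‖g x‖ ^ 2)]
  refine mul_le_mul_of_nonneg_right ?_ (by positivity)
  exact le_mul_of_one_le_right (abs_nonneg _) (by linarith [norm_nonneg x])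

lemma rpow_sub_one_bound {r ε : ℝ} (hr : 0 < r) (he : 0 < ε) (he2 : ε ≤ 1 / 2) :
    |(r ^ (2 * ε) - 1) / ε| ≤ 2 * (|Real.log r| * (1 + r)) := by
  rw [abs_div, abs_of_pos he, div_le_iff₀ he]
  rcases le_or_gt 1 r with h | h
  · have hl := Real.log_nonneg h
    have h1 : 1 ≤ r ^ (2 * ε) := one_le_rpow h (by positivity)
    have h2 : r ^ (2 * ε) ≤ r := by
      conv_rhs => rw [← Real.rpow_one r]
      exact rpow_le_rpow_of_exponent_le h (by linarith)
    rw [abs_of_nonneg (by linarith), abs_of_nonneg hl]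
    have h3 := Real.one_sub_inv_le_log_of_pos (show 0 < r ^ (2 * ε) by positivity)
    rw [Real.log_rpow hr] at h3
    have h4 : r ^ (2 * ε) - 1 ≤ 2 * ε * Real.log r * r ^ (2 * ε) := by
      have := mul_le_mul_of_nonneg_right h3 (show 0 ≤ r ^ (2 * ε) by positivity)
      rwa [sub_mul, inv_mul_cancel₀ (by positivity), one_mul] at this
    have h5 : 2 * ε * Real.log r * r ^ (2 * ε) ≤ 2 * ε * Real.log r * (1 + r) := by
      gcongr
      linarith
    linarith
  · have hl := Real.log_nonpos hr.le h.le
    have h1 : r ^ (2 * ε) ≤ 1 := rpow_le_one hr.le h.le (by positivity)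
    rw [abs_of_nonpos (by linarith), abs_of_nonpos hl]
    have h3 := Real.add_one_le_exp (Real.log r * (2 * ε))
    rw [← Real.rpow_def_of_pos hr] at h3
    have h4 : 0 ≤ -Real.log r * r * ε := by
      have : 0 ≤ -Real.log r := by linarith
      positivity
    linarith

open Filter Topology in
lemma tendstoA {n : ℕ} (hn : 1 ≤ n) (f : SchwartzMap (EuclideanSpace ℝ (Fin n)) ℂ) :
    Tendsto (fun ε : ℝ => ∫ x, (‖x‖ ^ (2 * ε) - 1) / ε * ‖f x‖ ^ 2) (𝓝[>] 0)
      (𝓝 (2 * ∫ x, Real.log ‖x‖ * ‖f x‖ ^ 2)) := by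
  have hf := f.continuous.measurable
  rw [← integral_const_mul]
  refine tendsto_integral_filter_of_dominated_convergence
    (fun x => 2 * (|Real.log ‖x‖| * (1 + ‖x‖) * ‖f x‖ ^ 2)) ?_ ?_ ((logInt hn f).const_mul 2) ?_
  · filter_upwards with ε
    exact Measurable.aestronglyMeasurable (by fun_prop)
  · filter_upwards [Ioo_mem_nhdsGT (show (0:ℝ) < 1/2 by norm_num)] with ε he
    filter_upwards [ae_ne_zero_E hn] with x hx
    have hx' : 0 < ‖x‖ := norm_pos_iff.mpr hx
    rw [norm_mul, Real.norm_eq_abs, Real.norm_of_nonneg (by positivity : 0 ≤ ‖f x‖ ^ 2), ← mul_assoc]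
    exact mul_le_mul_of_nonneg_right (rpow_sub_one_bound hx' he.1 he.2.le) (by positivity)
  · filter_upwards [ae_ne_zero_E hn] with x hx
    have hx' : 0 < ‖x‖ := norm_pos_iff.mpr hx
    rw [← mul_assoc]
    refine Tendsto.mul_const _ ?_
    have hd : HasDerivAt (fun ε : ℝ => ‖x‖ ^ (2 * ε)) (2 * Real.log ‖x‖) 0 := by
      have := ((hasDerivAt_id (0:ℝ)).const_mul 2).const_rpow hx'
      simpa [mul_comm] using this
    have := (hasDerivAt_iff_tendsto_slope.mp hd).mono_left
      (nhdsWithin_mono _ (fun y (hy : (0:ℝ) < y) => hy.ne' : Set.Ioi (0:ℝ) ⊆ {0}ᶜ))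
    refine this.congr fun ε => ?_
    simp [slope_def_field]

lemma Aint {n : ℕ} (f : SchwartzMap (EuclideanSpace ℝ (Fin n)) ℂ) {ε : ℝ}
    (he : 0 < ε) (he2 : ε ≤ 1 / 2) : Integrable (fun x => ‖x‖ ^ (2 * ε) * ‖f x‖ ^ 2) := by
  have hf := f.continuous.measurable
  refine ((sqInt f 0).add (sqInt f 1)).mono' (Measurable.aestronglyMeasurable (by fun_prop)) ?_
  filter_upwards with x
  rw [Real.norm_of_nonneg (by positivity)]
  simp only [Pi.add_apply, pow_zero, pow_one, ← add_mul]
  refine mul_le_mul_of_nonneg_right ?_ (by positivity)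
  rcases le_or_gt 1 ‖x‖ with h | h
  · have : ‖x‖ ^ (2 * ε) ≤ ‖x‖ := by
      conv_rhs => rw [← Real.rpow_one ‖x‖]
      exact rpow_le_rpow_of_exponent_le h (by linarith)
    linarith
  · have : ‖x‖ ^ (2 * ε) ≤ 1 := rpow_le_one (norm_nonneg _) h.le (by positivity)
    linarith [norm_nonneg x]

open Filter Topology

/-- Beckner's logarithmic uncertainty principle. -/
theorem log_uncertainty_fourier {n : ℕ} (hn : 1 ≤ n)
    (f : SchwartzMap (EuclideanSpace ℝ (Fin n)) ℂ) :
    (∫ x : EuclideanSpace ℝ (Fin n), Real.log ‖x‖ * ‖f x‖ ^ 2) +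
      (∫ ξ : EuclideanSpace ℝ (Fin n), Real.log ‖ξ‖ * ‖fourierTr (⇑f) ξ‖ ^ 2) ≥
    (deriv Real.Gamma ((n : ℝ) / 4) / Real.Gamma ((n : ℝ) / 4) + Real.log 2) *
      ∫ x : EuclideanSpace ℝ (Fin n), ‖f x‖ ^ 2 := by
  obtain ⟨G, hG, hPl⟩ := fourierSchwartz f
  have hGf : fourierTr (⇑f) = ⇑G := (funext hG).symm
  have hm : Measurable (fourierTr (⇑f)) := hGf ▸ G.continuous.measurable
  have hpitt := fun (ε : ℝ) => pitt hn f (ε := ε) hm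
  rw [hGf] at hpitt ⊢
  have ha : 0 < (n : ℝ) / 4 := by
    have : (1 : ℝ) ≤ n := by exact_mod_cast hn
    positivity
  set a : ℝ := (n : ℝ) / 4
  set L := ∫ x : EuclideanSpace ℝ (Fin n), Real.log ‖x‖ * ‖f x‖ ^ 2
  set Lh := ∫ x : EuclideanSpace ℝ (Fin n), Real.log ‖x‖ * ‖G x‖ ^ 2 with hLh
  set N := ∫ x : EuclideanSpace ℝ (Fin n), ‖f x‖ ^ 2 with hN
  have hGa : 0 < Gamma a := Gamma_pos_of_pos ha
  let C : ℝ → ℝ := fun ε => 4 ^ (-ε) * Gamma (a - ε) / Gamma (a + ε)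
  let q : ℝ → ℝ := fun ε => ∫ x, (‖x‖ ^ (2 * ε) - 1) / ε * ‖f x‖ ^ 2
  have hC0 : C 0 = 1 := by simp [C, hGa.ne']
  have hCd : HasDerivAt C (-Real.log 4 - 2 * (deriv Gamma a / Gamma a)) 0 := by
    have hd : HasDerivAt Gamma (deriv Gamma a) a :=
      (Real.differentiableAt_Gamma fun m => by
        have : (0:ℝ) ≤ m := Nat.cast_nonneg m
        linarith).hasDerivAt
    have h1 : HasDerivAt (fun ε : ℝ => (4:ℝ) ^ (-ε)) (-Real.log 4) 0 := by
      have := ((hasDerivAt_id (0:ℝ)).neg).const_rpow (show (0:ℝ) < 4 by norm_num)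
      simpa using this
    have h2 : HasDerivAt (fun ε : ℝ => Gamma (a - ε)) (-deriv Gamma a) 0 := by
      have := HasDerivAt.comp (0:ℝ) (h₂ := Gamma) (h := fun ε : ℝ => a - ε)
        (show HasDerivAt Gamma (deriv Gamma a) (a - 0) by rw [sub_zero]; exact hd)
        ((hasDerivAt_id (0:ℝ)).const_sub a)
      simpa [Function.comp_def] using this
    have h3 : HasDerivAt (fun ε : ℝ => Gamma (a + ε)) (deriv Gamma a) 0 := by
      have := HasDerivAt.comp (0:ℝ) (h₂ := Gamma) (h := fun ε : ℝ => a + ε)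
        (show HasDerivAt Gamma (deriv Gamma a) (a + 0) by rw [add_zero]; exact hd)
        ((hasDerivAt_id (0:ℝ)).const_add a)
      simpa [Function.comp_def] using this
    have h4 := (h1.mul h2).div h3 (by simpa using hGa.ne')
    refine HasDerivAt.congr_deriv (f := C) h4 ?_
    simp only [neg_zero, rpow_zero, sub_zero, add_zero, Pi.mul_apply]
    field_simp
    ring
  have hmono : 𝓝[>] (0:ℝ) ≤ 𝓝[≠] 0 :=
    nhdsWithin_mono _ (fun y (hy : (0:ℝ) < y) => hy.ne' : Set.Ioi (0:ℝ) ⊆ {0}ᶜ)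
  have hT : Tendsto (fun ε => C ε * q ε + (C ε - 1) / ε * N + 2 * Lh) (𝓝[>] 0)
      (𝓝 (1 * (2 * L) + (-Real.log 4 - 2 * (deriv Gamma a / Gamma a)) * N + 2 * Lh)) := by
    refine ((Tendsto.mul ?_ (tendstoA hn f)).add (Tendsto.mul_const _ ?_)).add_const _
    · rw [← hC0]
      exact hCd.continuousAt.tendsto.mono_left nhdsWithin_le_nhds
    · refine ((hasDerivAt_iff_tendsto_slope.mp hCd).mono_left hmono).congr fun ε => ?_
      simp [slope_def_field, hC0]
  have hpos : ∀ᶠ ε in 𝓝[>] (0:ℝ), 0 ≤ C ε * q ε + (C ε - 1) / ε * N + 2 * Lh := by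
    filter_upwards [Ioo_mem_nhdsGT (show (0:ℝ) < 1/2 by norm_num), Ioo_mem_nhdsGT ha] with ε he1 he2
    have he : 0 < ε := he1.1
    have hp := hpitt ε he he2.2
    have hfN : Integrable (fun x => ‖f x‖ ^ 2) := by simpa using sqInt f 0
    have hGN : Integrable (fun x => ‖G x‖ ^ 2) := by simpa using sqInt G 0
    have hCpos : 0 < C ε := div_pos (mul_pos (by positivity)
      (Gamma_pos_of_pos (by linarith [he2.2]))) (Gamma_pos_of_pos (by linarith))
    have hAi := Aint f he he1.2.le
    have hA0 : 0 ≤ ∫ x, ‖x‖ ^ (2 * ε) * ‖f x‖ ^ 2 := integral_nonneg fun x => by positivity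
    rw [← ofReal_integral_eq_lintegral_ofReal hAi (Eventually.of_forall fun x => by positivity),
      ← ENNReal.ofReal_mul hCpos.le] at hp
    have hlow : ENNReal.ofReal (∫ ξ, (‖G ξ‖ ^ 2 - 2 * ε * (Real.log ‖ξ‖ * ‖G ξ‖ ^ 2))) ≤
        ∫⁻ ξ, ENNReal.ofReal (‖ξ‖ ^ (-(2 * ε)) * ‖G ξ‖ ^ 2) := by
      refine (ofReal_int_le (hGN.sub ((logInt' hn G).const_mul _))).trans (lintegral_mono_ae ?_)
      filter_upwards [ae_ne_zero_E hn] with ξ hξ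
      have hx' : 0 < ‖ξ‖ := norm_pos_iff.mpr hξ
      refine ENNReal.ofReal_le_ofReal ?_
      have h3 := Real.add_one_le_exp (Real.log ‖ξ‖ * (-(2 * ε)))
      rw [← Real.rpow_def_of_pos hx'] at h3
      have := mul_le_mul_of_nonneg_right h3 (show 0 ≤ ‖G ξ‖ ^ 2 by positivity)
      change ‖G ξ‖ ^ 2 - 2 * ε * (Real.log ‖ξ‖ * ‖G ξ‖ ^ 2) ≤ ‖ξ‖ ^ (-(2 * ε)) * ‖G ξ‖ ^ 2
      linarith
    have hfin := (ENNReal.ofReal_le_ofReal_iff (mul_nonneg hCpos.le hA0)).mp (hlow.trans hp)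
    rw [integral_sub hGN ((logInt' hn G).const_mul _), integral_const_mul, hPl] at hfin
    have hq : ∫ x, ‖x‖ ^ (2 * ε) * ‖f x‖ ^ 2 = N + ε * q ε := by
      rw [← integral_const_mul, hN, ← integral_add hfN]
      · refine integral_congr_ae (Eventually.of_forall fun x => ?_)
        field_simp
        ring
      · refine ((hAi.sub hfN)).congr (Eventually.of_forall fun x => ?_)
        simp only [Pi.sub_apply]
        field_simp
    rw [hq] at hfin
    change N - 2 * ε * Lh ≤ C ε * (N + ε * q ε) at hfin
    have : C ε * q ε + (C ε - 1) / ε * N + 2 * Lh =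
      (C ε * (N + ε * q ε) - (N - 2 * ε * Lh)) / ε := by
      field_simp
      ring
    rw [this]
    exact div_nonneg (by linarith) he.le
  have hfinal := ge_of_tendsto hT hpos
  have hlog4 : Real.log 4 = 2 * Real.log 2 := by
    rw [show (4:ℝ) = 2 ^ (2:ℕ) by norm_num, Real.log_pow]
    norm_num
  rw [hlog4] at hfinal
  linarith
end
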